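/- Let 1 < r < ∞ and 1 < p < ∞, and let (f_n)_{n≥1} be a sequence of measurable functions on ℝ^d such that (Σ_{n=1}^∞ |f_n(·)|^r)^{1/r} ∈ L^p(μ_κ). Then ‖(Σ_{n=1}^∞ |M_κ f_n(·)|^r)^{1/r}‖_{κ,p} ≤ C ‖(Σ_{n=1}^∞ |f_n(·)|^r)^{1/r}‖_{κ,p}, where C = C(κ_1,…,κ_d,r,p) is independent of the sequence (f_n). -/

import Mathlib

noncomputable section
open MeasureTheory Set Real
open scoped ENNReal NNReal

/-- one-dimensional measure `dμ_κ(x) = |x|^{2κ} dx` -/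
def muK1 (κ : ℝ) : Measure ℝ :=
  volume.withDensity fun x => ENNReal.ofReal (|x| ^ (2 * κ))

/-- the measure `μ_κ` on `ℝ^d` with density `∏_j |x_j|^{2κ_j}` -/
def muK (d : ℕ) (κ : Fin d → ℝ) : Measure (Fin d → ℝ) :=
  volume.withDensity fun x => ENNReal.ofReal (∏ j, |x j| ^ (2 * κ j))

/-- the constant `M_κ = Γ(κ+1/2)/(Γ(κ)Γ(1/2))` -/
def Mconst (κ : ℝ) : ℝ := Real.Gamma (κ + 1/2) / (Real.Gamma κ * Real.Gamma (1/2))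

/-- `σ_{x,y,z}` -/
def sigma3 (x y z : ℝ) : ℝ := if x ≠ 0 ∧ y ≠ 0 then (x^2 + y^2 - z^2) / (2*x*y) else 0

/-- area of the (possibly degenerate) triangle with side lengths `x,y,z` (Heron) -/
def triArea (x y z : ℝ) : ℝ :=
  Real.sqrt (((x+y+z)/2) * ((x+y+z)/2 - x) * ((x+y+z)/2 - y) * ((x+y+z)/2 - z))

/-- the kernel `K_κ(x,y,z)` -/
def Kker (κ x y z : ℝ) : ℝ :=
  if |x - y| ≤ z ∧ z ≤ x + y then
    (2:ℝ) ^ (2*κ - 2) * Mconst κ * triArea x y z ^ (2*κ - 2) * (x*y*z) ^ (1 - 2*κ)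
  else 0

/-- density of the measure `ν^{κ,+}_{x,y}` with respect to Lebesgue measure -/
def nuDens (κ x y z : ℝ) : ℝ≥0∞ :=
  ENNReal.ofReal ((1/2) * Kker κ |x| |y| |z| * (1 - sigma3 x y z) * |z| ^ (2*κ))

/-- the measure `ν^{κ,+}_{x,y}` -/
def nuPlus (κ x y : ℝ) : Measure ℝ := volume.withDensity (nuDens κ x y)

/-- the product measure `υ^κ_{x,y} = ν^{κ_1,+}_{x_1,y_1} ⊗ ⋯ ⊗ ν^{κ_d,+}_{x_d,y_d}` -/
def upsilon (d : ℕ) (κ x y : Fin d → ℝ) : Measure (Fin d → ℝ) :=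
  volume.withDensity fun z => ∏ j, nuDens (κ j) (x j) (y j) (z j)

/-- the set `ℝ^d_reg` of regular points -/
def regSet (d : ℕ) : Set (Fin d → ℝ) := {x | ∀ j, x j ≠ 0}

/-- the Euclidean ball of radius `r` centered at the origin -/
def eBall (d : ℕ) (r : ℝ) : Set (Fin d → ℝ) := {x | ∑ j, (x j)^2 < r^2}

/-- the open cube `Q_r` -/
def cubeQ (d : ℕ) (r : ℝ) : Set (Fin d → ℝ) := {x | ∀ j, |x j| < r}

/-- the constant `c_κ` with `c_κ⁻¹ = ∫ e^{-‖x‖²/2} dμ_κ` -/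
def cKappa (d : ℕ) (κ : Fin d → ℝ) : ℝ :=
  (∫ x, Real.exp (-(∑ j, (x j)^2) / 2) ∂(muK d κ))⁻¹

open Classical in
/-- the `ℤ_2^d` Dunkl maximal operator (explicit form), vanishing off `ℝ^d_reg` -/
def Mdunkl (d : ℕ) (κ : Fin d → ℝ) (f : (Fin d → ℝ) → ℝ) (x : Fin d → ℝ) : ℝ≥0∞ :=
  if x ∈ regSet d then
    ⨆ (r : ℝ) (_ : 0 < r), ENNReal.ofReal
      ((cKappa d κ / (muK d κ (eBall d r)).toReal) *
        |∫ y in regSet d, f y * (upsilon d κ x (-y) (eBall d r)).toReal ∂(muK d κ)|)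
  else 0

/-- the cube Dunkl maximal operator `M_κ^Q` (explicit form) -/
def MdunklQ (d : ℕ) (κ : Fin d → ℝ) (f : (Fin d → ℝ) → ℝ) (x : Fin d → ℝ) : ℝ≥0∞ :=
  ⨆ (r : ℝ) (_ : 0 < r), ENNReal.ofReal
    ((cKappa d κ / (muK d κ (cubeQ d r)).toReal) *
      |∫ y in regSet d, f y * (upsilon d κ x (-y) (cubeQ d r)).toReal ∂(muK d κ)|)

/-- the interval `I(x,r) = [max{0,|x|-r}, |x|+r)` -/
def Iset (x r : ℝ) : Set ℝ := Set.Ico (max 0 (|x| - r)) (|x| + r)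

/-- the rectangle `R(z,r) = I(z_1,r) × ⋯ × I(z_d,r)` -/
def Rset (d : ℕ) (z : Fin d → ℝ) (r : ℝ) : Set (Fin d → ℝ) :=
  Set.univ.pi fun j => Iset (z j) r

/-- the weighted maximal operator `M_κ^R` -/
def MR (d : ℕ) (κ : Fin d → ℝ) (f : (Fin d → ℝ) → ℝ) (x : Fin d → ℝ) : ℝ≥0∞ :=
  ⨆ (r : ℝ) (_ : 0 < r),
    (muK d κ (Rset d x r))⁻¹ *
      ∫⁻ y in {y | (fun j => |y j|) ∈ Rset d x r}, ENNReal.ofReal |f y| ∂(muK d κ)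

/-- Rösler's explicit formula for the one-dimensional Dunkl translation `τ_x^κ f(y)` -/
def tauK (κ x : ℝ) (f : ℝ → ℝ) (y : ℝ) : ℝ :=
  (1/2) * (∫ t in Set.Ioo (-1:ℝ) 1,
      f (Real.sqrt (x^2 + y^2 + 2*x*y*t)) *
        (1 + (x + y) / Real.sqrt (x^2 + y^2 + 2*x*y*t)) *
        (Mconst κ * (1 + t) * (1 - t^2) ^ (κ - 1)))
  + (1/2) * (∫ t in Set.Ioo (-1:ℝ) 1,
      f (-Real.sqrt (x^2 + y^2 + 2*x*y*t)) *
        (1 - (x + y) / Real.sqrt (x^2 + y^2 + 2*x*y*t)) *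
        (Mconst κ * (1 + t) * (1 - t^2) ^ (κ - 1)))

/-- an `ℝ≥0∞`-valued `L^p` norm for `ℝ≥0∞`-valued functions -/
def lpNormE {α : Type*} [MeasurableSpace α] (g : α → ℝ≥0∞) (p : ℝ≥0∞) (μ : Measure α) : ℝ≥0∞ :=
  if p = ∞ then essSup g μ else (∫⁻ x, g x ^ p.toReal ∂μ) ^ (1 / p.toReal)

/-- the Hardy–Littlewood maximal operator over cubes centered at `x` -/
def HLmax (d : ℕ) (f : (Fin d → ℝ) → ℝ) (x : Fin d → ℝ) : ℝ≥0∞ :=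
  ⨆ (r : ℝ) (_ : 0 < r),
    (volume {y : Fin d → ℝ | ∀ j, |y j - x j| < r})⁻¹ *
      ∫⁻ y in {y : Fin d → ℝ | ∀ j, |y j - x j| < r}, ENNReal.ofReal |f y| ∂volume

/-! ### Maximal operators over countable Vitali families -/

/-- A countable family of measurable sets with sizes `δ` and enlargements `B (star i)` for which
the Vitali covering argument works. -/
structure VitaliBasis {X ι : Type*} [MeasurableSpace X] (B : ι → Set X) (star : ι → ι)
    (δ : ι → ℝ) : Prop where
  measurableSet : ∀ i, MeasurableSet (B i)
  size_nonneg : ∀ i, 0 ≤ δ i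
  engulf : ∀ i j, (B i ∩ B j).Nonempty → δ i ≤ 2 * δ j → B i ⊆ B (star j)

/-- The uncentered maximal operator over a family of sets. -/
def maxOp {X ι : Type*} [MeasurableSpace X] (B : ι → Set X) (ν : Measure X) (f : X → ℝ≥0∞)
    (x : X) : ℝ≥0∞ :=
  ⨆ (i : ι) (_ : x ∈ B i), (ν (B i))⁻¹ * ∫⁻ y in B i, f y ∂ν

section MaximalOperator

variable {X ι : Type*} [MeasurableSpace X] {B : ι → Set X} {star : ι → ι} {δ : ι → ℝ}
  {ν : Measure X}

theorem le_maxOp {f : X → ℝ≥0∞} {x : X} {i : ι} (hx : x ∈ B i) :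
    (ν (B i))⁻¹ * ∫⁻ y in B i, f y ∂ν ≤ maxOp B ν f x :=
  le_iSup₂_of_le i hx le_rfl

theorem maxOp_const_mul {f : X → ℝ≥0∞} {c : ℝ≥0∞} (hf : Measurable f) (x : X) :
    maxOp B ν (fun y => c * f y) x = c * maxOp B ν f x := by
  unfold maxOp
  simp_rw [ENNReal.mul_iSup, lintegral_const_mul _ hf, mul_left_comm]

theorem maxOp_tsum_le {f : ℕ → X → ℝ≥0∞} (hf : ∀ n, Measurable (f n)) (x : X) :
    maxOp B ν (fun y => ∑' n, f n y) x ≤ ∑' n, maxOp B ν (f n) x := by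
  refine iSup₂_le fun i hi => ?_
  rw [lintegral_tsum fun n => (hf n).aemeasurable, ← ENNReal.tsum_mul_left]
  exact ENNReal.tsum_le_tsum fun n => le_maxOp hi

theorem measurable_maxOp [Countable ι] (hB : VitaliBasis B star δ) (f : X → ℝ≥0∞) :
    Measurable (maxOp B ν f) := by
  classical
  refine Measurable.iSup fun i => ?_
  have : (fun x => ⨆ (_ : x ∈ B i), (ν (B i))⁻¹ * ∫⁻ y in B i, f y ∂ν) =
      (B i).indicator fun _ => (ν (B i))⁻¹ * ∫⁻ y in B i, f y ∂ν := by
    ext x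
    by_cases hx : x ∈ B i <;> simp [hx]
  rw [this]
  exact measurable_const.indicator (hB.measurableSet i)

theorem maxOp_le_add {f g : X → ℝ≥0∞} {c : ℝ≥0∞} (hg : Measurable g)
    (h : ∀ x, f x ≤ g x + c) (x : X) : maxOp B ν f x ≤ maxOp B ν g x + c := by
  refine iSup₂_le fun i hi => ?_
  calc (ν (B i))⁻¹ * ∫⁻ y in B i, f y ∂ν
      ≤ (ν (B i))⁻¹ * ∫⁻ y in B i, (g y + c) ∂ν := by gcongr; exact h _
    _ = (ν (B i))⁻¹ * ∫⁻ y in B i, g y ∂ν + c * ((ν (B i))⁻¹ * ν (B i)) := by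
        rw [lintegral_add_left hg, setLIntegral_const]; ring
    _ ≤ maxOp B ν g x + c := by
        gcongr
        · exact le_maxOp hi
        · exact mul_le_of_le_one_right' (ENNReal.inv_mul_le_one _)

theorem mul_measure_maxOp_gt_le [Countable ι] (hB : VitaliBasis B star δ) {D : ℝ≥0}
    (hD : ∀ i, ν (B (star i)) ≤ D * ν (B i)) (f : X → ℝ≥0∞) (t : ℝ≥0∞) :
    t * ν {x | t < maxOp B ν f x} ≤ D * ∫⁻ x, f x ∂ν := by
  set T : ℕ → Set ι := fun N => {i | t < (ν (B i))⁻¹ * ∫⁻ y in B i, f y ∂ν ∧ δ i ≤ N} with hT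
  have hset : {x | t < maxOp B ν f x} = ⋃ N, ⋃ i ∈ T N, B i := by
    ext x
    simp only [maxOp, mem_ofPred_eq, lt_iSup_iff, mem_iUnion, hT]
    constructor
    · rintro ⟨i, hi, h⟩
      obtain ⟨N, hN⟩ := exists_nat_ge (δ i)
      exact ⟨N, i, ⟨h, hN⟩, hi⟩
    · rintro ⟨N, i, ⟨h, -⟩, hi⟩
      exact ⟨i, hi, h⟩
  have hmono : Monotone fun N => ⋃ i ∈ T N, B i := fun M N h =>
    biUnion_subset_biUnion_left fun i hi => ⟨hi.1, hi.2.trans (by exact_mod_cast h)⟩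
  rw [hset, hmono.measure_iUnion, ENNReal.mul_iSup]
  refine iSup_le fun N => ?_
  have hlt : ∀ i ∈ T N, t * ν (B i) ≤ ∫⁻ y in B i, f y ∂ν := by
    intro i hi
    by_cases h0 : ν (B i) = 0
    · simp [h0]
    by_cases h1 : ν (B i) = ∞
    · have := hi.1
      simp [h1] at this
    have := hi.1.le
    rwa [mul_comm, ← div_eq_mul_inv, ENNReal.le_div_iff_mul_le (Or.inl h0) (Or.inl h1)] at this
  have hne : ∀ i ∈ T N, (B i).Nonempty := by
    intro i hi
    by_contra h
    rw [not_nonempty_iff_eq_empty] at h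
    have := hi.1
    simp [h] at this
  obtain ⟨u, huT, hdisj, hcov⟩ := Vitali.exists_disjoint_subfamily_covering_enlargement B (T N) δ 2
    one_lt_two (fun a _ => hB.size_nonneg a) N (fun a ha => ha.2) hne
  have hsub : ⋃ i ∈ T N, B i ⊆ ⋃ j ∈ u, B (star j) := by
    refine iUnion₂_subset fun i hi => ?_
    obtain ⟨b, hb, h1, h2⟩ := hcov i hi
    exact (hB.engulf i b h1 h2).trans (subset_biUnion_of_mem (u := fun j => B (star j)) hb)
  have hu : u.Countable := u.to_countable
  calc t * ν (⋃ i ∈ T N, B i) ≤ t * ∑' j : u, ν (B (star j)) := by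
        gcongr
        exact (measure_mono hsub).trans (measure_biUnion_le ν hu _)
    _ ≤ t * ∑' j : u, D * ν (B j) := by
        gcongr; exact hD _
    _ = D * ∑' j : u, t * ν (B j) := by
        rw [ENNReal.tsum_mul_left, ENNReal.tsum_mul_left]; ring
    _ ≤ D * ∑' j : u, ∫⁻ y in B j, f y ∂ν := by
        gcongr with j; exact hlt _ (huT j.2)
    _ = D * ∫⁻ y in ⋃ j ∈ u, B j, f y ∂ν := by
        rw [lintegral_biUnion hu (fun i _ => hB.measurableSet i) hdisj]
    _ ≤ D * ∫⁻ x, f x ∂ν := by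
        gcongr; exact Measure.restrict_le_self

/-- Every power is dominated by a dyadic sum over the levels it exceeds. -/
theorem rpow_le_tsum_dyadic {q : ℝ} (hq : 0 < q) (m : ℝ≥0∞) :
    m ^ q ≤ ∑' k : ℤ, if (2 : ℝ≥0∞) ^ (k + 1) < m then ((2 : ℝ≥0∞) ^ (k + 2)) ^ q else 0 := by
  rcases eq_or_ne m 0 with rfl | h0
  · simp [hq]
  rcases eq_or_ne m ∞ with rfl | h1
  · refine le_of_eq ?_
    rw [ENNReal.top_rpow_of_pos hq]
    symm
    refine ENNReal.eq_top_of_forall_nnreal_le fun c => ?_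
    obtain ⟨n, hn⟩ := ENNReal.exists_nat_gt (ENNReal.coe_ne_top (r := c ^ (1 / q)))
    refine le_trans ?_ (ENNReal.le_tsum (n : ℤ))
    have h2 : (2 : ℝ≥0∞) ^ ((n : ℤ) + 1) < ∞ := ENNReal.zpow_lt_top (by simp) (by simp) _
    rw [if_pos h2]
    have h3 : ((c ^ (1 / q) : ℝ≥0) : ℝ≥0∞) ≤ 2 ^ ((n : ℤ) + 2) := by
      refine hn.le.trans ?_
      have : ((n : ℤ) + 2) = ((n + 2 : ℕ) : ℤ) := by push_cast; ring
      rw [this, zpow_natCast]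
      have h4 : (n : ℝ≥0∞) ≤ ((2 ^ (n + 2) : ℕ) : ℝ≥0∞) := by
        exact_mod_cast (Nat.lt_two_pow_self.le.trans (Nat.pow_le_pow_right (by norm_num) (by omega)))
      simpa using h4
    calc (c : ℝ≥0∞) = ((c ^ (1 / q) : ℝ≥0) : ℝ≥0∞) ^ q := by
          rw [← ENNReal.coe_rpow_of_nonneg _ hq.le, ← NNReal.rpow_mul]
          simp [hq.ne']
      _ ≤ _ := ENNReal.rpow_le_rpow h3 hq.le
  · obtain ⟨n, hn⟩ := ENNReal.exists_mem_Ioc_zpow h0 h1 (y := 2) (by norm_num) (by simp)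
    refine le_trans ?_ (ENNReal.le_tsum (n - 1))
    have e1 : n - 1 + 1 = n := by ring
    have e2 : n - 1 + 2 = n + 1 := by ring
    rw [e1, e2, if_pos hn.1]
    exact ENNReal.rpow_le_rpow hn.2 hq.le

theorem tsum_dyadic_le {s : ℝ} (hs : 0 < s) :
    ∃ C : ℝ≥0, ∀ m : ℝ≥0∞,
      (∑' k : ℤ, if (2 : ℝ≥0∞) ^ k < m then ((2 : ℝ≥0∞) ^ k) ^ s else 0) ≤ C * m ^ s := by
  set ρ : ℝ≥0∞ := ((2 : ℝ≥0∞)⁻¹) ^ s with hρ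
  have hρ1 : ρ < 1 := ENNReal.rpow_lt_one (by simp) hs
  have hC : (1 - ρ)⁻¹ ≠ ∞ := by simp [tsub_eq_zero_iff_le, hρ1]
  refine ⟨((1 - ρ)⁻¹ + 1).toNNReal, fun m => ?_⟩
  rw [ENNReal.coe_toNNReal (by simp [hC])]
  rcases eq_or_ne m 0 with rfl | h0
  · simp
  rcases eq_or_ne m ∞ with rfl | h1
  · rw [ENNReal.top_rpow_of_pos hs, ENNReal.mul_top (by simp)]
    exact le_top
  obtain ⟨n, hn⟩ := ENNReal.exists_mem_Ioc_zpow h0 h1 (y := 2) (by norm_num) (by simp)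
  have hinj : Function.Injective fun j : ℕ => n - (j : ℤ) := fun a b h => by simpa using h
  rw [← hinj.tsum_eq]
  · have hterm : ∀ j : ℕ, (if (2 : ℝ≥0∞) ^ (n - (j : ℤ)) < m then
        ((2 : ℝ≥0∞) ^ (n - (j : ℤ))) ^ s else 0) ≤ m ^ s * ρ ^ j := by
      intro j
      have : (2 : ℝ≥0∞) ^ (n - (j : ℤ)) = 2 ^ n * (2⁻¹) ^ j := by
        rw [ENNReal.zpow_sub (by simp) (by simp), zpow_natCast, ENNReal.inv_pow]
      split_ifs
      · rw [this, ENNReal.mul_rpow_of_nonneg _ _ hs.le, hρ, ← ENNReal.rpow_natCast (_ ^ s),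
          ← ENNReal.rpow_mul, mul_comm s, ENNReal.rpow_mul, ENNReal.rpow_natCast]
        gcongr
        exact hn.1.le
      · exact zero_le
    calc _ ≤ ∑' j : ℕ, m ^ s * ρ ^ j := ENNReal.tsum_le_tsum hterm
      _ = (1 - ρ)⁻¹ * m ^ s := by rw [ENNReal.tsum_mul_left, ENNReal.tsum_geometric, mul_comm]
      _ ≤ _ := by gcongr; exact le_self_add
  · intro k hk
    simp only [Function.mem_support, ne_eq, ite_eq_right_iff, Classical.not_imp] at hk
    have h2 : k ≤ n := by
      by_contra h
      have h3 : n + 1 ≤ k := by omega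
      exact absurd ((hk.1.trans_le hn.2)) (not_lt.2 (ENNReal.zpow_le_of_le (by norm_num) h3))
    exact ⟨(n - k).toNat, by simp [h2]⟩

/-- Maximal theorem in `L^q` for measures that are doubling along the family. -/
theorem lintegral_maxOp_rpow_le [Countable ι] (hB : VitaliBasis B star δ) (D : ℝ≥0) {q : ℝ}
    (hq : 1 < q) :
    ∃ A : ℝ≥0, 0 < A ∧ ∀ ν : Measure X, (∀ i, ν (B (star i)) ≤ D * ν (B i)) →
      ∀ f : X → ℝ≥0∞, Measurable f →
      ∫⁻ x, maxOp B ν f x ^ q ∂ν ≤ A * ∫⁻ x, f x ^ q ∂ν := by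
  have hq0 : 0 < q := by linarith
  have hs : 0 < q - 1 := by linarith
  obtain ⟨C, hC⟩ := tsum_dyadic_le hs
  refine ⟨4 ^ q * D * C + 1, by positivity, ?_⟩
  intro ν hD f hf
  have hweak : ∀ k : ℤ, ν {x | (2 : ℝ≥0∞) ^ (k + 1) < maxOp B ν f x} ≤
      (2 ^ k)⁻¹ * (D * ∫⁻ x, (if 2 ^ k < f x then f x else 0) ∂ν) := by
    intro k
    have hk0 : (2 : ℝ≥0∞) ^ k ≠ 0 := (ENNReal.zpow_pos (by simp) (by simp) _).ne'
    have hk1 : (2 : ℝ≥0∞) ^ k ≠ ∞ := (ENNReal.zpow_lt_top (by simp) (by simp) _).ne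
    have hg : Measurable fun x => if 2 ^ k < f x then f x else 0 :=
      Measurable.ite (measurableSet_lt measurable_const hf) hf measurable_const
    have h1 : ∀ x, maxOp B ν f x ≤ maxOp B ν (fun x => if 2 ^ k < f x then f x else 0) x + 2 ^ k :=
      maxOp_le_add hg fun x => by
        split_ifs with h
        · exact le_self_add
        · simpa using h
    have h2 : {x | (2 : ℝ≥0∞) ^ (k + 1) < maxOp B ν f x} ⊆
        {x | (2 : ℝ≥0∞) ^ k < maxOp B ν (fun x => if 2 ^ k < f x then f x else 0) x} := by
      intro x hx
      have h3 : (2 : ℝ≥0∞) ^ (k + 1) = 2 ^ k + 2 ^ k := by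
        rw [ENNReal.zpow_add (by simp) (by simp), zpow_one, mul_two]
      have h4 := lt_of_lt_of_le (mem_ofPred_eq ▸ hx) (h1 x)
      rw [h3] at h4
      exact (ENNReal.add_lt_add_iff_right hk1).1 h4
    rw [mul_comm _ (_ * _), ← div_eq_mul_inv, ENNReal.le_div_iff_mul_le (Or.inl hk0) (Or.inl hk1), mul_comm]
    refine le_trans ?_ (mul_measure_maxOp_gt_le hB hD _ (2 ^ k))
    gcongr
  have hM : Measurable (maxOp B ν f) := measurable_maxOp hB f
  calc ∫⁻ x, maxOp B ν f x ^ q ∂ν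
      ≤ ∫⁻ x, ∑' k : ℤ, (if (2 : ℝ≥0∞) ^ (k + 1) < maxOp B ν f x then
          ((2 : ℝ≥0∞) ^ (k + 2)) ^ q else 0) ∂ν := by
        gcongr with x; exact rpow_le_tsum_dyadic hq0 _
    _ = ∑' k : ℤ, ((2 : ℝ≥0∞) ^ (k + 2)) ^ q * ν {x | (2 : ℝ≥0∞) ^ (k + 1) < maxOp B ν f x} := by
        rw [lintegral_tsum]
        · congr! 2 with k
          rw [← lintegral_indicator_const (measurableSet_lt measurable_const hM)]
          congr! 2 with x
          simp [indicator_apply]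
        · intro k
          exact (Measurable.ite (measurableSet_lt measurable_const hM) measurable_const
            measurable_const).aemeasurable
    _ ≤ ∑' k : ℤ, ((2 : ℝ≥0∞) ^ (k + 2)) ^ q *
          ((2 ^ k)⁻¹ * (D * ∫⁻ x, (if 2 ^ k < f x then f x else 0) ∂ν)) := by
        gcongr with k; exact hweak k
    _ = ∑' k : ℤ, (4 : ℝ≥0∞) ^ q * D *
          ∫⁻ x, f x * (if 2 ^ k < f x then ((2 : ℝ≥0∞) ^ k) ^ (q - 1) else 0) ∂ν := by
        congr! 2 with k
        have hk0 : (2 : ℝ≥0∞) ^ k ≠ 0 := (ENNReal.zpow_pos (by simp) (by simp) _).ne'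
        have hk1 : (2 : ℝ≥0∞) ^ k ≠ ∞ := (ENNReal.zpow_lt_top (by simp) (by simp) _).ne
        have e1 : ((2 : ℝ≥0∞) ^ (k + 2)) ^ q = 4 ^ q * (2 ^ k) ^ q := by
          rw [ENNReal.zpow_add (by simp) (by simp), ENNReal.mul_rpow_of_nonneg _ _ hq0.le, mul_comm]
          norm_num
        have e2 : ((2 : ℝ≥0∞) ^ k) ^ q * (2 ^ k)⁻¹ = (2 ^ k) ^ (q - 1) := by
          rw [ENNReal.rpow_sub _ _ hk0 hk1, ENNReal.rpow_one, div_eq_mul_inv]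
        have e3 : ∫⁻ x, f x * (if 2 ^ k < f x then ((2 : ℝ≥0∞) ^ k) ^ (q - 1) else 0) ∂ν =
            (2 ^ k) ^ (q - 1) * ∫⁻ x, (if 2 ^ k < f x then f x else 0) ∂ν := by
          rw [← lintegral_const_mul _
            (Measurable.ite (measurableSet_lt measurable_const hf) hf measurable_const)]
          congr! 2 with x
          split_ifs <;> ring
        rw [e1, e3, ← e2]
        ring
    _ = (4 : ℝ≥0∞) ^ q * D * ∫⁻ x, f x *
          (∑' k : ℤ, if 2 ^ k < f x then ((2 : ℝ≥0∞) ^ k) ^ (q - 1) else 0) ∂ν := by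
        rw [ENNReal.tsum_mul_left, ← lintegral_tsum]
        · simp_rw [ENNReal.tsum_mul_left]
        · intro k
          exact (hf.mul (Measurable.ite (measurableSet_lt measurable_const hf) measurable_const
            measurable_const)).aemeasurable
    _ ≤ (4 : ℝ≥0∞) ^ q * D * ∫⁻ x, C * f x ^ q ∂ν := by
        refine mul_le_mul_right (lintegral_mono fun x => ?_) _
        calc f x * _ ≤ f x * (C * f x ^ (q - 1)) := by gcongr; exact hC _
          _ = C * f x ^ q := by
            nth_rw 1 [← ENNReal.rpow_one (f x)]
            rw [mul_left_comm, ← ENNReal.rpow_add_of_nonneg _ _ zero_le_one hs.le]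
            congr 2; ring
    _ = (4 : ℝ≥0∞) ^ q * D * C * ∫⁻ x, f x ^ q ∂ν := by
        rw [lintegral_const_mul _ (hf.pow_const _)]; ring
    _ ≤ _ := by
        gcongr
        rw [ENNReal.coe_add, ENNReal.coe_mul, ENNReal.coe_mul,
          ENNReal.coe_rpow_of_nonneg _ hq0.le]
        exact le_self_add

end MaximalOperator

section Weights

variable {X ι : Type*} [MeasurableSpace X] {B : ι → Set X} {star : ι → ι} {δ : ι → ℝ}
  {μ : Measure X}

theorem rpow_lintegral_le {q : ℝ} (hq : 1 ≤ q) {f : X → ℝ≥0∞} (hf : Measurable f) :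
    (∫⁻ x, f x ∂μ) ^ q ≤ μ univ ^ (q - 1) * ∫⁻ x, f x ^ q ∂μ := by
  have hq0 : 0 < q := by linarith
  have h := ENNReal.lintegral_mul_norm_pow_le (μ := μ) (f := fun x => f x ^ q)
    (g := fun _ => (1 : ℝ≥0∞)) (hf.pow_const q).aemeasurable aemeasurable_const (p := 1 / q)
    (q := 1 - 1 / q) (by positivity) (by rw [sub_nonneg, div_le_one hq0]; exact hq) (by ring)
  simp only [ENNReal.one_rpow, mul_one, lintegral_const, one_mul, ← ENNReal.rpow_mul,
    mul_one_div_cancel hq0.ne', ENNReal.rpow_one] at h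
  calc (∫⁻ x, f x ∂μ) ^ q ≤ ((∫⁻ x, f x ^ q ∂μ) ^ (1 / q) * μ univ ^ (1 - 1 / q)) ^ q := by
        gcongr
    _ = _ := by
        rw [ENNReal.mul_rpow_of_nonneg _ _ hq0.le, ← ENNReal.rpow_mul, ← ENNReal.rpow_mul,
          one_div_mul_cancel hq0.ne', ENNReal.rpow_one, mul_comm]
        congr 2
        field_simp

theorem rpow_tsum_mul_le {q : ℝ} (hq : 1 ≤ q) (w a : ℕ → ℝ≥0∞) :
    (∑' k, w k * a k) ^ q ≤ (∑' k, w k) ^ (q - 1) * ∑' k, w k * a k ^ q := by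
  have h := rpow_lintegral_le (μ := Measure.count.withDensity w) hq (f := a) measurable_from_top
  rw [lintegral_withDensity_eq_lintegral_mul _ measurable_from_top measurable_from_top,
    lintegral_withDensity_eq_lintegral_mul _ measurable_from_top measurable_from_top,
    withDensity_apply _ MeasurableSet.univ, Measure.restrict_univ, lintegral_count, lintegral_count,
    lintegral_count] at h
  exact h

theorem exists_pos_lintegral_rpow_le [SigmaFinite μ] {q : ℝ} (hq : 0 < q) {ε : ℝ≥0∞}
    (hε : ε ≠ 0) :
    ∃ g : X → ℝ≥0∞, Measurable g ∧ (∀ x, 0 < g x) ∧ ∫⁻ x, g x ^ q ∂μ ≤ ε := by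
  obtain ⟨g, hg, hgm, hgi⟩ := exists_pos_lintegral_lt_of_sigmaFinite μ hε
  refine ⟨fun x => (g x : ℝ≥0∞) ^ (1 / q), hgm.coe_nnreal_ennreal.pow_const _, fun x => ?_, ?_⟩
  · exact ENNReal.rpow_pos (by simpa using hg x) (by simp)
  · simpa [← ENNReal.rpow_mul, hq.ne'] using hgi.le

/-- Rubio de Francia's iteration: every function in `L^q` has a positive majorant of comparable
norm which is an `A₁` weight. -/
theorem exists_majorant_maxOp_le [Countable ι] [SigmaFinite μ] (hB : VitaliBasis B star δ)
    {D : ℝ≥0} (hD : ∀ i, μ (B (star i)) ≤ D * μ (B i)) {q : ℝ} (hq : 1 < q) :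
    ∃ K C : ℝ≥0, ∀ φ : X → ℝ≥0∞, Measurable φ → ∫⁻ x, φ x ^ q ∂μ ≠ 0 →
      ∃ H : X → ℝ≥0∞, Measurable H ∧ (∀ x, 0 < H x) ∧ (∀ x, φ x ≤ H x) ∧
        ∫⁻ x, H x ^ q ∂μ ≤ C * ∫⁻ x, φ x ^ q ∂μ ∧ ∀ x, maxOp B μ H x ≤ K * H x := by
  have hq0 : 0 < q := by linarith
  obtain ⟨A, hA, hAM⟩ := lintegral_maxOp_rpow_le hB D hq
  replace hAM := hAM μ hD
  set a : ℝ≥0 := A ^ (1 / q) with ha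
  have ha0 : 0 < a := NNReal.rpow_pos hA
  have haq : (a : ℝ≥0∞)⁻¹ ^ q * A = 1 := by
    rw [ENNReal.inv_rpow, ← ENNReal.coe_rpow_of_nonneg _ hq0.le, ha, ← NNReal.rpow_mul,
      one_div_mul_cancel hq0.ne', NNReal.rpow_one]
    exact ENNReal.inv_mul_cancel (by simpa using hA.ne') (by simp)
  refine ⟨2 * a, 2 ^ (q - 1) * 2 * (2 ^ (q - 1) * 2), fun φ hφ hφ0 => ?_⟩
  obtain ⟨g, hg, hg0, hgi⟩ := exists_pos_lintegral_rpow_le (μ := μ) hq0 hφ0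
  set ψ : ℕ → X → ℝ≥0∞ := fun k =>
    (fun (u : X → ℝ≥0∞) x => (a : ℝ≥0∞)⁻¹ * maxOp B μ u x)^[k] (φ + g) with hψ
  have hψs : ∀ k x, ψ (k + 1) x = (a : ℝ≥0∞)⁻¹ * maxOp B μ (ψ k) x := by
    intro k x
    simp only [hψ, Function.iterate_succ_apply']
  have hψm : ∀ k, Measurable (ψ k) := by
    intro k
    cases k with
    | zero => exact hφ.add hg
    | succ k =>
      rw [funext (hψs k)]
      exact (measurable_maxOp hB _).const_mul _
  have hψi : ∀ k, ∫⁻ x, ψ k x ^ q ∂μ ≤ ∫⁻ x, (φ x + g x) ^ q ∂μ := by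
    intro k
    induction k with
    | zero => exact le_rfl
    | succ k ih =>
      refine le_trans ?_ ih
      simp_rw [hψs, ENNReal.mul_rpow_of_nonneg _ _ hq0.le]
      rw [lintegral_const_mul _ ((measurable_maxOp hB _).pow_const _)]
      calc _ ≤ (a : ℝ≥0∞)⁻¹ ^ q * (A * ∫⁻ x, ψ k x ^ q ∂μ) := by gcongr; exact hAM _ (hψm k)
        _ = _ := by rw [← mul_assoc, haq, one_mul]
  have hsum : ∫⁻ x, (φ x + g x) ^ q ∂μ ≤ 2 ^ (q - 1) * 2 * ∫⁻ x, φ x ^ q ∂μ := by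
    calc ∫⁻ x, (φ x + g x) ^ q ∂μ ≤ ∫⁻ x, 2 ^ (q - 1) * (φ x ^ q + g x ^ q) ∂μ := by
          gcongr with x
          exact ENNReal.rpow_add_le_mul_rpow_add_rpow _ _ hq.le
      _ = 2 ^ (q - 1) * (∫⁻ x, φ x ^ q ∂μ + ∫⁻ x, g x ^ q ∂μ) := by
          rw [← lintegral_add_left (hφ.pow_const _)]
          exact lintegral_const_mul _ ((hφ.pow_const _).add (hg.pow_const _))
      _ ≤ 2 ^ (q - 1) * (∫⁻ x, φ x ^ q ∂μ + ∫⁻ x, φ x ^ q ∂μ) := by gcongr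
      _ = _ := by ring
  have hw : ∑' k : ℕ, (2⁻¹ : ℝ≥0∞) ^ k = 2 := by
    rw [ENNReal.tsum_geometric, ENNReal.one_sub_inv_two, inv_inv]
  have hle : ∀ x, φ x + g x ≤ ∑' k, (2⁻¹ : ℝ≥0∞) ^ k * ψ k x := fun x => by
    refine le_trans (le_of_eq ?_) (ENNReal.le_tsum 0)
    simp [hψ]
  refine ⟨fun x => ∑' k, (2⁻¹ : ℝ≥0∞) ^ k * ψ k x, Measurable.tsum fun k =>
    (hψm k).const_mul _, fun x => ?_, fun x => le_self_add.trans (hle x), ?_, fun x => ?_⟩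
  · exact (hg0 x).trans_le (le_add_self.trans (hle x))
  · calc ∫⁻ x, (∑' k, (2⁻¹ : ℝ≥0∞) ^ k * ψ k x) ^ q ∂μ
        ≤ ∫⁻ x, 2 ^ (q - 1) * ∑' k, (2⁻¹ : ℝ≥0∞) ^ k * ψ k x ^ q ∂μ := by
          gcongr with x
          refine (rpow_tsum_mul_le hq.le _ _).trans (le_of_eq ?_)
          rw [hw]
      _ = 2 ^ (q - 1) * ∑' k : ℕ, (2⁻¹ : ℝ≥0∞) ^ k * ∫⁻ x, ψ k x ^ q ∂μ := by
          rw [lintegral_const_mul _ (Measurable.tsum fun k =>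
            ((hψm k).pow_const _).const_mul _), lintegral_tsum fun k =>
            (((hψm k).pow_const _).const_mul _).aemeasurable]
          congr! 3 with k
          exact lintegral_const_mul _ ((hψm k).pow_const _)
      _ ≤ 2 ^ (q - 1) * ∑' k : ℕ, (2⁻¹ : ℝ≥0∞) ^ k * (2 ^ (q - 1) * 2 * ∫⁻ x, φ x ^ q ∂μ) := by
          gcongr with k
          exact (hψi k).trans hsum
      _ = _ := by
          rw [ENNReal.tsum_mul_right, hw]
          push_cast
          rw [ENNReal.coe_rpow_of_nonneg _ (by linarith)]
          push_cast
          ring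
  · calc maxOp B μ (fun x => ∑' k, (2⁻¹ : ℝ≥0∞) ^ k * ψ k x) x
        ≤ ∑' k, maxOp B μ (fun x => (2⁻¹ : ℝ≥0∞) ^ k * ψ k x) x :=
          maxOp_tsum_le (fun k => (hψm k).const_mul _) x
      _ = ∑' k, 2 * a * ((2⁻¹ : ℝ≥0∞) ^ (k + 1) * ψ (k + 1) x) := by
          congr! 2 with k
          rw [maxOp_const_mul (hψm k), hψs, pow_succ]
          have h2 : (2 : ℝ≥0∞) * 2⁻¹ = 1 := ENNReal.mul_inv_cancel (by simp) (by simp)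
          have h3 : (a : ℝ≥0∞) * (a : ℝ≥0∞)⁻¹ = 1 :=
            ENNReal.mul_inv_cancel (by simpa using ha0.ne') (by simp)
          calc _ = (2 * 2⁻¹) * (a * (a : ℝ≥0∞)⁻¹) * (2⁻¹ ^ k * maxOp B μ (ψ k) x) := by
                rw [h2, h3, one_mul, one_mul]
            _ = _ := by ring
      _ ≤ 2 * a * ∑' k, (2⁻¹ : ℝ≥0∞) ^ k * ψ k x := by
          rw [ENNReal.tsum_mul_left]
          refine mul_le_mul' le_rfl ?_
          exact ENNReal.tsum_comp_le_tsum_of_injective (Nat.succ_injective)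
            fun k => (2⁻¹ : ℝ≥0∞) ^ k * ψ k x
      _ = _ := by push_cast; ring

theorem setLIntegral_ne_top_of_rpow {q : ℝ} (hq : 1 < q) {s : Set X} (hs : μ s ≠ ∞)
    {H : X → ℝ≥0∞} (hH : Measurable H) (hi : ∫⁻ x, H x ^ q ∂μ ≠ ∞) : ∫⁻ x in s, H x ∂μ ≠ ∞ := by
  have h := rpow_lintegral_le (μ := μ.restrict s) hq.le hH
  have h2 : (μ.restrict s) univ ^ (q - 1) * ∫⁻ x in s, H x ^ q ∂μ ≠ ∞ := by
    refine ENNReal.mul_ne_top ?_ (ne_top_of_le_ne_top hi (setLIntegral_le_lintegral _ _))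
    rw [Measure.restrict_apply_univ]
    exact ENNReal.rpow_ne_top_of_nonneg (by linarith) hs
  have h3 := ne_top_of_le_ne_top h2 h
  intro h4
  rw [h4, ENNReal.top_rpow_of_pos (by linarith)] at h3
  exact h3 rfl

theorem withDensity_star_le (hB : VitaliBasis B star δ) (h0 : ∀ i, μ (B i) ≠ 0)
    (h1 : ∀ i, μ (B i) ≠ ∞) {D K : ℝ≥0} (hD : ∀ i, μ (B (star i)) ≤ D * μ (B i))
    {v : X → ℝ≥0∞} (hv : Measurable v) (hK : ∀ x, maxOp B μ v x ≤ K * v x) (i : ι) :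
    μ.withDensity v (B (star i)) ≤ (D * K : ℝ≥0) * μ.withDensity v (B i) := by
  have hsub : B i ⊆ B (star i) := hB.engulf i i
    (by simpa using nonempty_of_measure_ne_zero (h0 i)) (by linarith [hB.size_nonneg i])
  rw [withDensity_apply _ (hB.measurableSet _), withDensity_apply _ (hB.measurableSet _)]
  set I := ∫⁻ x in B (star i), v x ∂μ with hI
  have h2 : μ (B i) * ((μ (B (star i)))⁻¹ * I) ≤ K * ∫⁻ x in B i, v x ∂μ := by
    rw [mul_comm, ← setLIntegral_const, ← lintegral_const_mul (K : ℝ≥0∞) hv]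
    exact setLIntegral_mono (hv.const_mul _) fun x hx => (le_maxOp (hsub hx)).trans (hK x)
  calc I = μ (B (star i)) * (μ (B (star i)))⁻¹ * I := by
        rw [ENNReal.mul_inv_cancel (h0 _) (h1 _), one_mul]
    _ ≤ D * μ (B i) * (μ (B (star i)))⁻¹ * I := by gcongr; exact hD i
    _ = D * (μ (B i) * ((μ (B (star i)))⁻¹ * I)) := by ring
    _ ≤ D * (K * ∫⁻ x in B i, v x ∂μ) := by gcongr
    _ = _ := by push_cast; ring

theorem setLIntegral_ne_zero_of_pos {s : Set X} (hs : μ s ≠ 0) {v : X → ℝ≥0∞} (hv : Measurable v)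
    (hv0 : ∀ x, 0 < v x) : ∫⁻ x in s, v x ∂μ ≠ 0 := by
  have h : Function.support v = univ := by ext x; simp [(hv0 x).ne']
  rw [← pos_iff_ne_zero, setLIntegral_pos_iff hv, h, univ_inter]
  exact pos_iff_ne_zero.2 hs

theorem lintegral_maxOp_rpow_mul_le [Countable ι] (hB : VitaliBasis B star δ)
    (h0 : ∀ i, μ (B i) ≠ 0) (h1 : ∀ i, μ (B i) ≠ ∞) {D : ℝ≥0}
    (hD : ∀ i, μ (B (star i)) ≤ D * μ (B i)) (K : ℝ≥0) {r : ℝ} (hr : 1 < r) :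
    ∃ C : ℝ≥0, ∀ v : X → ℝ≥0∞, Measurable v → (∀ x, 0 < v x) →
      (∀ i, ∫⁻ x in B i, v x ∂μ ≠ ∞) → (∀ x, maxOp B μ v x ≤ K * v x) →
      ∀ f : X → ℝ≥0∞, Measurable f →
        ∫⁻ x, maxOp B μ f x ^ r * v x ∂μ ≤ C * ∫⁻ x, f x ^ r * v x ∂μ := by
  obtain ⟨A, -, hA⟩ := lintegral_maxOp_rpow_le hB (D * K) hr
  have hr0 : 0 < r := by linarith
  refine ⟨K ^ r * A, fun v hv hv0 hvi hK f hf => ?_⟩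
  set ν := μ.withDensity v with hν
  have hνB : ∀ i, ν (B i) = ∫⁻ x in B i, v x ∂μ := fun i => withDensity_apply _ (hB.measurableSet i)
  have hle : ∀ x, maxOp B μ f x ≤ K * maxOp B ν f x := by
    refine fun x => iSup₂_le fun i hi => ?_
    have e0 : ν (B i) ≠ 0 := by rw [hνB]; exact setLIntegral_ne_zero_of_pos (h0 i) hv hv0
    have e1 : ν (B i) ≠ ∞ := by rw [hνB]; exact hvi i
    have e2 : (μ (B i))⁻¹ * ν (B i) * ∫⁻ y in B i, f y ∂μ ≤ K * ∫⁻ y in B i, f y ∂ν := by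
      rw [← lintegral_const_mul _ hf, ← lintegral_const_mul _ hf, hν,
        setLIntegral_withDensity_eq_setLIntegral_mul _ hv (hf.const_mul _) (hB.measurableSet i),
        ← hν]
      refine setLIntegral_mono (hv.mul (hf.const_mul _)) fun y hy => ?_
      calc (μ (B i))⁻¹ * ν (B i) * f y ≤ K * v y * f y := by
            refine mul_le_mul' ?_ le_rfl
            rw [hνB]
            exact (le_maxOp hy).trans (hK y)
        _ = (v * fun y => K * f y) y := by simp only [Pi.mul_apply]; ring
    calc (μ (B i))⁻¹ * ∫⁻ y in B i, f y ∂μ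
        = (ν (B i))⁻¹ * ((μ (B i))⁻¹ * ν (B i) * ∫⁻ y in B i, f y ∂μ) := by
          rw [show (ν (B i))⁻¹ * ((μ (B i))⁻¹ * ν (B i) * ∫⁻ y in B i, f y ∂μ) =
            ((ν (B i))⁻¹ * ν (B i)) * ((μ (B i))⁻¹ * ∫⁻ y in B i, f y ∂μ) by ring,
            ENNReal.inv_mul_cancel e0 e1, one_mul]
      _ ≤ (ν (B i))⁻¹ * (K * ∫⁻ y in B i, f y ∂ν) := by gcongr
      _ = K * ((ν (B i))⁻¹ * ∫⁻ y in B i, f y ∂ν) := by ring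
      _ ≤ K * maxOp B ν f x := by gcongr; exact le_maxOp hi
  have hMm : Measurable (maxOp B ν f) := measurable_maxOp hB f
  calc ∫⁻ x, maxOp B μ f x ^ r * v x ∂μ
      ≤ ∫⁻ x, K ^ r * (v * fun x => maxOp B ν f x ^ r) x ∂μ := by
        refine lintegral_mono fun x => ?_
        calc maxOp B μ f x ^ r * v x ≤ (K * maxOp B ν f x) ^ r * v x := by gcongr; exact hle x
          _ = _ := by
            rw [ENNReal.mul_rpow_of_nonneg _ _ hr0.le, Pi.mul_apply]; ring
    _ = K ^ r * ∫⁻ x, maxOp B ν f x ^ r ∂ν := by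
        rw [lintegral_const_mul _ (hv.mul (hMm.pow_const _)), hν,
          lintegral_withDensity_eq_lintegral_mul _ hv (hMm.pow_const _)]
    _ ≤ K ^ r * (A * ∫⁻ x, f x ^ r ∂ν) := by
        gcongr
        exact hA ν (withDensity_star_le hB h0 h1 hD hv hK) f hf
    _ = _ := by
        rw [hν, lintegral_withDensity_eq_lintegral_mul _ hv (hf.pow_const _), ENNReal.coe_mul,
          ENNReal.coe_rpow_of_nonneg _ hr0.le, mul_assoc]
        simp_rw [Pi.mul_apply, mul_comm (v _)]

theorem lintegral_maxOp_rpow_mul_rpow_le [Countable ι] (hB : VitaliBasis B star δ)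
    (h0 : ∀ i, μ (B i) ≠ 0) (h1 : ∀ i, μ (B i) ≠ ∞) {D : ℝ≥0}
    (hD : ∀ i, μ (B (star i)) ≤ D * μ (B i)) (K : ℝ≥0) {r : ℝ} (hr : 1 < r) :
    ∃ C : ℝ≥0, ∀ v : X → ℝ≥0∞, Measurable v → (∀ x, 0 < v x) → (∀ᵐ x ∂μ, v x ≠ ∞) →
      (∀ i, ∫⁻ x in B i, v x ∂μ ≠ ∞) → (∀ x, maxOp B μ v x ≤ K * v x) →
      ∀ f : X → ℝ≥0∞, Measurable f →
        ∫⁻ x, maxOp B μ f x ^ r * v x ^ (1 - r) ∂μ ≤ C * ∫⁻ x, f x ^ r * v x ^ (1 - r) ∂μ := by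
  obtain ⟨A, -, hA⟩ := lintegral_maxOp_rpow_le hB (D * K) hr
  have hr0 : 0 < r := by linarith
  refine ⟨K ^ r * A, fun v hv hv0 hvt hvi hK f hf => ?_⟩
  set ν := μ.withDensity v with hν
  have hνB : ∀ i, ν (B i) = ∫⁻ x in B i, v x ∂μ := fun i => withDensity_apply _ (hB.measurableSet i)
  set g : X → ℝ≥0∞ := fun x => f x * (v x)⁻¹ with hg
  have hgm : Measurable g := hf.mul hv.inv
  have hle : ∀ x, maxOp B μ f x ≤ K * v x * maxOp B ν g x := by
    refine fun x => iSup₂_le fun i hi => ?_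
    have e0 : ν (B i) ≠ 0 := by rw [hνB]; exact setLIntegral_ne_zero_of_pos (h0 i) hv hv0
    have e1 : ν (B i) ≠ ∞ := by rw [hνB]; exact hvi i
    have e2 : ∫⁻ y in B i, f y ∂μ = ∫⁻ y in B i, g y ∂ν := by
      rw [hν, setLIntegral_withDensity_eq_setLIntegral_mul _ hv hgm (hB.measurableSet i)]
      refine lintegral_congr_ae (ae_restrict_of_ae ?_)
      filter_upwards [hvt] with y hy
      rw [Pi.mul_apply, hg, mul_left_comm, ENNReal.mul_inv_cancel (hv0 y).ne' hy, mul_one]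
    calc (μ (B i))⁻¹ * ∫⁻ y in B i, f y ∂μ
        = ((μ (B i))⁻¹ * ν (B i)) * ((ν (B i))⁻¹ * ∫⁻ y in B i, g y ∂ν) := by
          rw [show ((μ (B i))⁻¹ * ν (B i)) * ((ν (B i))⁻¹ * ∫⁻ y in B i, g y ∂ν) =
            (ν (B i) * (ν (B i))⁻¹) * ((μ (B i))⁻¹ * ∫⁻ y in B i, g y ∂ν) by ring,
            ENNReal.mul_inv_cancel e0 e1, one_mul, e2]
      _ ≤ K * v x * maxOp B ν g x := by
          refine mul_le_mul' ?_ (le_maxOp hi)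
          rw [hνB]
          exact (le_maxOp hi).trans (hK x)
  have hMm : Measurable (maxOp B ν g) := measurable_maxOp hB g
  calc ∫⁻ x, maxOp B μ f x ^ r * v x ^ (1 - r) ∂μ
      ≤ ∫⁻ x, K ^ r * (v * fun x => maxOp B ν g x ^ r) x ∂μ := by
        refine lintegral_mono_ae ?_
        filter_upwards [hvt] with x hx
        calc maxOp B μ f x ^ r * v x ^ (1 - r)
            ≤ (K * v x * maxOp B ν g x) ^ r * v x ^ (1 - r) := by gcongr; exact hle x
          _ = K ^ r * ((v x ^ r * v x ^ (1 - r)) * maxOp B ν g x ^ r) := by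
            rw [ENNReal.mul_rpow_of_nonneg _ _ hr0.le, ENNReal.mul_rpow_of_nonneg _ _ hr0.le]; ring
          _ = _ := by
            rw [← ENNReal.rpow_add _ _ (hv0 x).ne' hx, add_sub_cancel, ENNReal.rpow_one,
              Pi.mul_apply]
    _ = K ^ r * ∫⁻ x, maxOp B ν g x ^ r ∂ν := by
        rw [lintegral_const_mul _ (hv.mul (hMm.pow_const _)), hν,
          lintegral_withDensity_eq_lintegral_mul _ hv (hMm.pow_const _)]
    _ ≤ K ^ r * (A * ∫⁻ x, g x ^ r ∂ν) := by
        gcongr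
        exact hA ν (withDensity_star_le hB h0 h1 hD hv hK) g hgm
    _ = _ := by
        rw [hν, lintegral_withDensity_eq_lintegral_mul _ hv (hgm.pow_const _), ENNReal.coe_mul,
          ENNReal.coe_rpow_of_nonneg _ hr0.le, mul_assoc]
        congr 2
        refine lintegral_congr_ae ?_
        filter_upwards [hvt] with x hx
        rw [Pi.mul_apply, hg, ENNReal.mul_rpow_of_nonneg _ _ hr0.le, mul_left_comm,
          ENNReal.rpow_sub _ _ (hv0 x).ne' hx, ENNReal.rpow_one, ENNReal.inv_rpow, div_eq_mul_inv]

end Weights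

section VectorValued

variable {X ι : Type*} [MeasurableSpace X] {B : ι → Set X} {star : ι → ι} {δ : ι → ℝ}
  {μ : Measure X}

theorem setLIntegral_rpow_le {s : ℝ} (hs : 0 < s) (hs1 : s ≤ 1) {E : Set X} (h0 : μ E ≠ 0)
    (h1 : μ E ≠ ∞) {H : X → ℝ≥0∞} (hH : Measurable H) :
    (μ E)⁻¹ * ∫⁻ x in E, H x ^ s ∂μ ≤ ((μ E)⁻¹ * ∫⁻ x in E, H x ∂μ) ^ s := by
  have h := rpow_lintegral_le (μ := μ.restrict E) (q := 1 / s) (by rw [le_div_iff₀ hs]; linarith)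
    (hH.pow_const s)
  simp only [← ENNReal.rpow_mul, mul_one_div_cancel hs.ne', ENNReal.rpow_one,
    Measure.restrict_apply_univ] at h
  have h2 := ENNReal.rpow_le_rpow h hs.le
  rw [← ENNReal.rpow_mul, one_div_mul_cancel hs.ne', ENNReal.rpow_one,
    ENNReal.mul_rpow_of_nonneg _ _ hs.le, ← ENNReal.rpow_mul] at h2
  calc (μ E)⁻¹ * ∫⁻ x in E, H x ^ s ∂μ
      ≤ (μ E)⁻¹ * (μ E ^ ((1 / s - 1) * s) * (∫⁻ x in E, H x ∂μ) ^ s) := by gcongr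
    _ = (μ E ^ (-1 : ℝ) * μ E ^ ((1 / s - 1) * s)) * (∫⁻ x in E, H x ∂μ) ^ s := by
        rw [ENNReal.rpow_neg_one]; ring
    _ = _ := by
        rw [← ENNReal.rpow_add _ _ h0 h1, ENNReal.mul_rpow_of_nonneg _ _ hs.le,
          ← ENNReal.rpow_neg_one, ← ENNReal.rpow_mul]
        congr 2
        field_simp
        ring

theorem maxOp_rpow_le (h0 : ∀ i, μ (B i) ≠ 0) (h1 : ∀ i, μ (B i) ≠ ∞) {s : ℝ} (hs : 0 < s)
    (hs1 : s ≤ 1) {H : X → ℝ≥0∞} (hH : Measurable H) (x : X) :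
    maxOp B μ (fun y => H y ^ s) x ≤ maxOp B μ H x ^ s :=
  iSup₂_le fun i hi => (setLIntegral_rpow_le hs hs1 (h0 i) (h1 i) hH).trans
    (ENNReal.rpow_le_rpow (le_maxOp hi) hs.le)

theorem ennreal_rpow_le_rpow_of_nonpos {a b : ℝ≥0∞} {t : ℝ} (ht : t ≤ 0) (h : a ≤ b) :
    b ^ t ≤ a ^ t := by
  rw [← neg_neg t, ENNReal.rpow_neg b, ENNReal.rpow_neg a, ENNReal.inv_le_inv]
  exact ENNReal.rpow_le_rpow h (neg_nonneg.2 ht)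

theorem maxOp_eq_zero {f : X → ℝ≥0∞} (hf : f =ᵐ[μ] 0) (x : X) : maxOp B μ f x = 0 := by
  have h : ∀ i, ∫⁻ y in B i, f y ∂μ = 0 := fun i => by
    rw [lintegral_congr_ae (ae_restrict_of_ae hf)]; simp
  simp [maxOp, h]

theorem ae_eq_zero_of_lintegral_tsum_rpow {F : ℕ → X → ℝ≥0∞} (hF : ∀ n, Measurable (F n))
    {r t : ℝ} (hr : 0 < r) (ht : 0 < t) (h : ∫⁻ x, (∑' n, F n x ^ r) ^ t ∂μ = 0) (n : ℕ) :
    F n =ᵐ[μ] 0 := by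
  rw [lintegral_eq_zero_iff ((Measurable.tsum fun n => (hF n).pow_const r).pow_const t)] at h
  filter_upwards [h] with x hx
  have h2 := (ENNReal.rpow_eq_zero_iff_of_pos ht).1 hx
  rw [ENNReal.tsum_eq_zero] at h2
  exact (ENNReal.rpow_eq_zero_iff_of_pos hr).1 (h2 n)

theorem vector_valued_maxOp_of_lt [Countable ι] [SigmaFinite μ] (hB : VitaliBasis B star δ)
    (h0 : ∀ i, μ (B i) ≠ 0) (h1 : ∀ i, μ (B i) ≠ ∞) {D : ℝ≥0}
    (hD : ∀ i, μ (B (star i)) ≤ D * μ (B i)) {r p : ℝ} (hp : 1 < p) (hpr : p < r) :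
    ∃ C : ℝ≥0, ∀ F : ℕ → X → ℝ≥0∞, (∀ n, Measurable (F n)) →
      ∫⁻ x, (∑' n, F n x ^ r) ^ (p / r) ∂μ ≠ ∞ →
      ∫⁻ x, (∑' n, maxOp B μ (F n) x ^ r) ^ (p / r) ∂μ ≤
        C * ∫⁻ x, (∑' n, F n x ^ r) ^ (p / r) ∂μ := by
  have hr : 1 < r := by linarith
  have hr0 : 0 < r := by linarith
  have hp0 : 0 < p := by linarith
  have hpr0 : 0 < p / r := by positivity
  set s : ℝ := (r - p) / (r - 1) with hs
  have hs0 : 0 < s := div_pos (by linarith) (by linarith)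
  have hs1 : s ≤ 1 := by rw [hs, div_le_one (by linarith)]; linarith
  have hsr : s * (1 - r) = p - r := by
    rw [hs]; field_simp [show r - 1 ≠ 0 by linarith]; ring
  obtain ⟨K, C₁, hmaj⟩ := exists_majorant_maxOp_le hB hD hp
  obtain ⟨C₂, hC₂⟩ := lintegral_maxOp_rpow_mul_rpow_le hB h0 h1 hD (K ^ s) hr
  refine ⟨C₂ ^ (p / r) * C₁ ^ (1 - p / r), fun F hF hfin => ?_⟩
  have hMm : ∀ n, Measurable (maxOp B μ (F n)) := fun n => measurable_maxOp hB _
  by_cases hz : ∫⁻ x, (∑' n, F n x ^ r) ^ (p / r) ∂μ = 0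
  · simp [maxOp_eq_zero (ae_eq_zero_of_lintegral_tsum_rpow hF hr0 hpr0 hz _), hr0, hpr0]
  set G : X → ℝ≥0∞ := fun x => (∑' n, F n x ^ r) ^ (1 / r) with hG
  have hGm : Measurable G := (Measurable.tsum fun n => (hF n).pow_const r).pow_const _
  have hGp : ∀ x, G x ^ p = (∑' n, F n x ^ r) ^ (p / r) := fun x => by
    rw [hG, ← ENNReal.rpow_mul, one_div_mul_eq_div]
  have hGr : ∀ x, G x ^ r = ∑' n, F n x ^ r := fun x => by
    rw [hG, ← ENNReal.rpow_mul, one_div_mul_cancel hr0.ne', ENNReal.rpow_one]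
  simp_rw [← hGp] at hz hfin ⊢
  obtain ⟨H, hHm, hH0, hGH, hHi, hHK⟩ := hmaj G hGm hz
  have hHfin : ∫⁻ x, H x ^ p ∂μ ≠ ∞ :=
    ne_top_of_le_ne_top (ENNReal.mul_ne_top ENNReal.coe_ne_top hfin) hHi
  have hHt : ∀ᵐ x ∂μ, H x ≠ ∞ := by
    filter_upwards [ae_lt_top (hHm.pow_const p) hHfin] with x hx hx'
    rw [hx', ENNReal.top_rpow_of_pos hp0] at hx
    exact lt_irrefl _ hx
  have hv : ∀ x, (H x ^ s) ^ (1 - r) = H x ^ (p - r) := fun x => by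
    rw [← ENNReal.rpow_mul, hsr]
  have hkey := hC₂ (fun x => H x ^ s) (hHm.pow_const s)
    (fun x => ENNReal.rpow_pos_of_nonneg (hH0 x) hs0.le)
    (by
      filter_upwards [hHt] with x hx
      exact ENNReal.rpow_ne_top_of_nonneg hs0.le hx)
    (fun i => by
      have h3 := setLIntegral_rpow_le hs0 hs1 (h0 i) (h1 i) hHm
      have h4 : ((μ (B i))⁻¹ * ∫⁻ x in B i, H x ∂μ) ^ s ≠ ∞ :=
        ENNReal.rpow_ne_top_of_nonneg hs0.le (ENNReal.mul_ne_top (ENNReal.inv_ne_top.2 (h0 i))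
          (setLIntegral_ne_top_of_rpow hp (h1 i) hHm hHfin))
      intro h5
      rw [h5, ENNReal.mul_top (ENNReal.inv_ne_zero.2 (h1 i))] at h3
      exact h4 (top_le_iff.1 h3))
    (fun x => by
      calc _ ≤ maxOp B μ H x ^ s := maxOp_rpow_le h0 h1 hs0 hs1 hHm x
        _ ≤ (K * H x) ^ s := ENNReal.rpow_le_rpow (hHK x) hs0.le
        _ = _ := by rw [ENNReal.mul_rpow_of_nonneg _ _ hs0.le, ENNReal.coe_rpow_of_nonneg _ hs0.le])
  simp_rw [hv] at hkey
  have hHpr : Measurable fun x => H x ^ (p - r) := hHm.pow_const _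
  have hsumM : Measurable fun x => ∑' n, maxOp B μ (F n) x ^ r :=
    Measurable.tsum fun n => (hMm n).pow_const r
  have hstep : ∫⁻ x, (∑' n, maxOp B μ (F n) x ^ r) * H x ^ (p - r) ∂μ ≤ C₂ * ∫⁻ x, G x ^ p ∂μ := by
    calc ∫⁻ x, (∑' n, maxOp B μ (F n) x ^ r) * H x ^ (p - r) ∂μ
        = ∑' n, ∫⁻ x, maxOp B μ (F n) x ^ r * H x ^ (p - r) ∂μ := by
          simp_rw [← ENNReal.tsum_mul_right]
          exact lintegral_tsum fun n => (((hMm n).pow_const r).mul hHpr).aemeasurable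
      _ ≤ ∑' n, C₂ * ∫⁻ x, F n x ^ r * H x ^ (p - r) ∂μ :=
          ENNReal.tsum_le_tsum fun n => hkey _ (hF n)
      _ = C₂ * ∫⁻ x, G x ^ r * H x ^ (p - r) ∂μ := by
          rw [ENNReal.tsum_mul_left]
          simp_rw [hGr, ← ENNReal.tsum_mul_right]
          exact congrArg _ (lintegral_tsum fun n => (((hF n).pow_const r).mul hHpr).aemeasurable).symm
      _ ≤ C₂ * ∫⁻ x, G x ^ p ∂μ := by
          refine mul_le_mul' le_rfl (lintegral_mono_ae ?_)
          filter_upwards [hHt] with x hx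
          rcases eq_or_ne (G x) 0 with hg | hg
          · simp [hg, hr0]
          have hgt : G x ≠ ∞ := ne_top_of_le_ne_top hx (hGH x)
          calc G x ^ r * H x ^ (p - r) ≤ G x ^ r * G x ^ (p - r) :=
                mul_le_mul' le_rfl (ennreal_rpow_le_rpow_of_nonpos (by linarith) (hGH x))
            _ = G x ^ p := by rw [← ENNReal.rpow_add _ _ hg hgt]; congr 1; ring
  calc ∫⁻ x, (∑' n, maxOp B μ (F n) x ^ r) ^ (p / r) ∂μ
      = ∫⁻ x, ((∑' n, maxOp B μ (F n) x ^ r) * H x ^ (p - r)) ^ (p / r) *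
          (H x ^ p) ^ (1 - p / r) ∂μ := by
        refine lintegral_congr_ae ?_
        filter_upwards [hHt] with x hx
        rw [ENNReal.mul_rpow_of_nonneg _ _ hpr0.le, ← ENNReal.rpow_mul, ← ENNReal.rpow_mul,
          mul_assoc, ← ENNReal.rpow_add _ _ (hH0 x).ne' hx,
          show (p - r) * (p / r) + p * (1 - p / r) = 0 by field_simp; ring, ENNReal.rpow_zero,
          mul_one]
    _ ≤ (∫⁻ x, (∑' n, maxOp B μ (F n) x ^ r) * H x ^ (p - r) ∂μ) ^ (p / r) *
          (∫⁻ x, H x ^ p ∂μ) ^ (1 - p / r) :=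
        ENNReal.lintegral_mul_norm_pow_le (hsumM.mul hHpr).aemeasurable
          (hHm.pow_const p).aemeasurable hpr0.le
          (by rw [sub_nonneg, div_le_one hr0]; exact hpr.le) (by ring)
    _ ≤ (C₂ * ∫⁻ x, G x ^ p ∂μ) ^ (p / r) * (C₁ * ∫⁻ x, G x ^ p ∂μ) ^ (1 - p / r) := by
        have : 0 ≤ 1 - p / r := by rw [sub_nonneg, div_le_one hr0]; exact hpr.le
        gcongr
    _ = _ := by
        have h1r : 0 ≤ 1 - p / r := by rw [sub_nonneg, div_le_one hr0]; exact hpr.le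
        rw [ENNReal.mul_rpow_of_nonneg _ _ hpr0.le, ENNReal.mul_rpow_of_nonneg _ _ h1r,
          ENNReal.coe_mul, ENNReal.coe_rpow_of_nonneg _ hpr0.le, ENNReal.coe_rpow_of_nonneg _ h1r,
          mul_mul_mul_comm, ← ENNReal.rpow_add _ _ hz hfin, add_sub_cancel, ENNReal.rpow_one]

theorem lintegral_sum_rpow_ne_top {g : ℕ → X → ℝ≥0∞} (hg : ∀ n, Measurable (g n)) {q : ℝ}
    (hq : 1 ≤ q) (h : ∀ n, ∫⁻ x, g n x ^ q ∂μ ≠ ∞) (N : ℕ) :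
    ∫⁻ x, (∑ n ∈ Finset.range N, g n x) ^ q ∂μ ≠ ∞ := by
  induction N with
  | zero => simp [show 0 < q by linarith]
  | succ N ih =>
    simp_rw [Finset.sum_range_succ]
    exact (ENNReal.lintegral_rpow_add_lt_top_of_lintegral_rpow_lt_top
      (Finset.measurable_fun_sum _ fun n _ => hg n).aemeasurable ih.lt_top (h N).lt_top hq).ne

theorem vector_valued_maxOp_of_gt [Countable ι] [SigmaFinite μ] (hB : VitaliBasis B star δ)
    (h0 : ∀ i, μ (B i) ≠ 0) (h1 : ∀ i, μ (B i) ≠ ∞) {D : ℝ≥0}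
    (hD : ∀ i, μ (B (star i)) ≤ D * μ (B i)) {r p : ℝ} (hr : 1 < r) (hpr : r < p) :
    ∃ C : ℝ≥0, ∀ F : ℕ → X → ℝ≥0∞, (∀ n, Measurable (F n)) →
      ∫⁻ x, (∑' n, F n x ^ r) ^ (p / r) ∂μ ≠ ∞ →
      ∫⁻ x, (∑' n, maxOp B μ (F n) x ^ r) ^ (p / r) ∂μ ≤
        C * ∫⁻ x, (∑' n, F n x ^ r) ^ (p / r) ∂μ := by
  have hr0 : 0 < r := by linarith
  have hp0 : 0 < p := by linarith
  have hp1 : 1 < p := by linarith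
  set q : ℝ := p / r with hq
  have hq1 : 1 < q := by rw [hq, lt_div_iff₀ hr0]; linarith
  have hq0 : 0 < q := by linarith
  have hqr : r * q = p := by rw [hq]; field_simp
  set q' : ℝ := q / (q - 1) with hq'
  have hq'1 : 1 < q' := by rw [hq', lt_div_iff₀ (by linarith)]; linarith
  have hqq' : (q - 1) * q' = q := by rw [hq']; field_simp [show q - 1 ≠ 0 by linarith]
  have hconj : q.HolderConjugate q' := Real.HolderConjugate.conjExponent hq1
  obtain ⟨A, -, hA⟩ := lintegral_maxOp_rpow_le hB D hp1
  obtain ⟨K, C₁, hmaj⟩ := exists_majorant_maxOp_le hB hD hq'1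
  obtain ⟨C₂, hC₂⟩ := lintegral_maxOp_rpow_mul_le hB h0 h1 hD K hr
  refine ⟨C₂ ^ q * C₁ ^ (q - 1), fun F hF hfin => ?_⟩
  have hMm : ∀ n, Measurable (maxOp B μ (F n)) := fun n => measurable_maxOp hB _
  set S : X → ℝ≥0∞ := fun x => ∑' n, F n x ^ r with hS
  have hSm : Measurable S := Measurable.tsum fun n => (hF n).pow_const r
  have hFS : ∀ n x, F n x ^ p ≤ S x ^ q := fun n x => by
    rw [← hqr, ENNReal.rpow_mul]
    exact ENNReal.rpow_le_rpow (ENNReal.le_tsum (f := fun n => F n x ^ r) n) hq0.le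
  have hpart : ∀ N, ∫⁻ x, (∑ n ∈ Finset.range N, maxOp B μ (F n) x ^ r) ^ q ∂μ ≤
      (C₂ ^ q * C₁ ^ (q - 1) : ℝ≥0) * ∫⁻ x, S x ^ q ∂μ := by
    intro N
    set Φ : X → ℝ≥0∞ := fun x => ∑ n ∈ Finset.range N, maxOp B μ (F n) x ^ r with hΦ
    have hΦm : Measurable Φ := Finset.measurable_fun_sum _ fun n _ => (hMm n).pow_const r
    have hIfin : ∫⁻ x, Φ x ^ q ∂μ ≠ ∞ := by
      refine lintegral_sum_rpow_ne_top (fun n => (hMm n).pow_const r) hq1.le (fun n => ?_) N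
      simp_rw [← ENNReal.rpow_mul, hqr]
      refine ne_top_of_le_ne_top ?_ (hA μ hD _ (hF n))
      exact ENNReal.mul_ne_top ENNReal.coe_ne_top
        (ne_top_of_le_ne_top hfin (lintegral_mono (hFS n)))
    by_cases hz : ∫⁻ x, Φ x ^ q ∂μ = 0
    · rw [hz]; exact zero_le
    have hφq : ∀ x, (Φ x ^ (q - 1)) ^ q' = Φ x ^ q := fun x => by
      rw [← ENNReal.rpow_mul, hqq']
    obtain ⟨H, hHm, hH0, hφH, hHi, hHK⟩ := hmaj (fun x => Φ x ^ (q - 1)) (hΦm.pow_const _)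
      (by simp_rw [hφq]; exact hz)
    simp_rw [hφq] at hHi
    have hHfin : ∫⁻ x, H x ^ q' ∂μ ≠ ∞ :=
      ne_top_of_le_ne_top (ENNReal.mul_ne_top ENNReal.coe_ne_top hIfin) hHi
    set I := ∫⁻ x, Φ x ^ q ∂μ with hI
    set J := ∫⁻ x, S x ^ q ∂μ with hJ
    have hmain : I ≤ C₂ * (J ^ (1 / q) * (C₁ * I) ^ (1 / q')) := by
      calc I = ∫⁻ x, Φ x * Φ x ^ (q - 1) ∂μ := by
            refine lintegral_congr fun x => ?_
            nth_rw 2 [← ENNReal.rpow_one (Φ x)]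
            rw [← ENNReal.rpow_add_of_nonneg _ _ zero_le_one (by linarith)]
            congr 1; ring
        _ ≤ ∫⁻ x, Φ x * H x ∂μ := by gcongr with x; exact hφH x
        _ = ∑ n ∈ Finset.range N, ∫⁻ x, maxOp B μ (F n) x ^ r * H x ∂μ := by
            simp_rw [hΦ, Finset.sum_mul]
            exact lintegral_finsetSum _ fun n _ => ((hMm n).pow_const r).mul hHm
        _ ≤ ∑ n ∈ Finset.range N, C₂ * ∫⁻ x, F n x ^ r * H x ∂μ := by
            gcongr with n _
            exact hC₂ H hHm hH0 (fun i => setLIntegral_ne_top_of_rpow hq'1 (h1 i) hHm hHfin) hHK _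
              (hF n)
        _ ≤ ∑' n, C₂ * ∫⁻ x, F n x ^ r * H x ∂μ := ENNReal.sum_le_tsum _
        _ = C₂ * ∫⁻ x, S x * H x ∂μ := by
            rw [ENNReal.tsum_mul_left]
            simp_rw [hS, ← ENNReal.tsum_mul_right]
            exact congrArg _ (lintegral_tsum fun n => (((hF n).pow_const r).mul hHm).aemeasurable).symm
        _ ≤ C₂ * (J ^ (1 / q) * (∫⁻ x, H x ^ q' ∂μ) ^ (1 / q')) := by
            gcongr
            exact ENNReal.lintegral_mul_le_Lp_mul_Lq μ hconj hSm.aemeasurable hHm.aemeasurable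
        _ ≤ C₂ * (J ^ (1 / q) * (C₁ * I) ^ (1 / q')) := by gcongr
    have h4 : I ^ q ≤ C₂ ^ q * J * (C₁ ^ (q - 1) * I ^ (q - 1)) := by
      have h5 : 1 / q' * q = q - 1 := by
        rw [hq']; field_simp
      calc I ^ q ≤ (C₂ * (J ^ (1 / q) * (C₁ * I) ^ (1 / q'))) ^ q :=
            ENNReal.rpow_le_rpow hmain hq0.le
        _ = _ := by
          rw [ENNReal.mul_rpow_of_nonneg _ _ hq0.le, ENNReal.mul_rpow_of_nonneg _ _ hq0.le,
            ← ENNReal.rpow_mul, ← ENNReal.rpow_mul, h5, one_div_mul_cancel hq0.ne',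
            ENNReal.rpow_one, ENNReal.mul_rpow_of_nonneg _ _ (by linarith)]
          ring
    have h6 : I ^ (q - 1) ≠ 0 := by simp [hz, hIfin]
    have h7 : I ^ (q - 1) ≠ ∞ := ENNReal.rpow_ne_top_of_nonneg (by linarith) hIfin
    have h8 : I ^ q = I * I ^ (q - 1) := by
      nth_rw 2 [← ENNReal.rpow_one I]
      rw [← ENNReal.rpow_add_of_nonneg _ _ zero_le_one (by linarith)]
      congr 1; ring
    rw [h8, show (C₂ : ℝ≥0∞) ^ q * J * (C₁ ^ (q - 1) * I ^ (q - 1)) =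
      (C₂ ^ q * C₁ ^ (q - 1) * J) * I ^ (q - 1) by ring] at h4
    rw [ENNReal.coe_mul, ENNReal.coe_rpow_of_nonneg _ hq0.le,
      ENNReal.coe_rpow_of_nonneg _ (by linarith)]
    exact (ENNReal.mul_le_mul_iff_left h6 h7).1 h4
  have hlim : ∫⁻ x, (∑' n, maxOp B μ (F n) x ^ r) ^ q ∂μ =
      ⨆ N, ∫⁻ x, (∑ n ∈ Finset.range N, maxOp B μ (F n) x ^ r) ^ q ∂μ := by
    rw [← lintegral_iSup]
    · refine lintegral_congr fun x => ?_
      rw [ENNReal.tsum_eq_iSup_nat]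
      exact (ENNReal.orderIsoRpow q hq0).map_iSup _
    · exact fun N => (Finset.measurable_fun_sum _ fun n _ => (hMm n).pow_const r).pow_const q
    · intro M N hMN x
      refine ENNReal.rpow_le_rpow ?_ hq0.le
      exact Finset.sum_le_sum_of_subset (Finset.range_mono hMN)
  rw [hlim]
  exact iSup_le hpart

/-- The Fefferman–Stein inequality for the maximal operator of a doubling measure. -/
theorem vector_valued_maxOp [Countable ι] [SigmaFinite μ] (hB : VitaliBasis B star δ)
    (h0 : ∀ i, μ (B i) ≠ 0) (h1 : ∀ i, μ (B i) ≠ ∞) {D : ℝ≥0}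
    (hD : ∀ i, μ (B (star i)) ≤ D * μ (B i)) {r p : ℝ} (hr : 1 < r) (hp : 1 < p) :
    ∃ C : ℝ≥0, ∀ F : ℕ → X → ℝ≥0∞, (∀ n, Measurable (F n)) →
      ∫⁻ x, (∑' n, F n x ^ r) ^ (p / r) ∂μ ≠ ∞ →
      ∫⁻ x, (∑' n, maxOp B μ (F n) x ^ r) ^ (p / r) ∂μ ≤
        C * ∫⁻ x, (∑' n, F n x ^ r) ^ (p / r) ∂μ := by
  rcases lt_trichotomy p r with hpr | rfl | hpr
  · exact vector_valued_maxOp_of_lt hB h0 h1 hD hp hpr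
  · obtain ⟨A, -, hA⟩ := lintegral_maxOp_rpow_le hB D hp
    refine ⟨A, fun F hF _ => ?_⟩
    simp only [div_self (show p ≠ 0 by linarith), ENNReal.rpow_one]
    rw [lintegral_tsum fun n => ((measurable_maxOp hB _).pow_const p).aemeasurable,
      lintegral_tsum fun n => ((hF n).pow_const p).aemeasurable, ← ENNReal.tsum_mul_left]
    exact ENNReal.tsum_le_tsum fun n => hA μ hD _ (hF n)
  · exact vector_valued_maxOp_of_gt hB h0 h1 hD hr hpr

end VectorValued

section FoldedBoxes

variable {d : ℕ} {κ : Fin d → ℝ}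

theorem measurable_muK_density (d : ℕ) (κ : Fin d → ℝ) :
    Measurable fun x : Fin d → ℝ => ENNReal.ofReal (∏ j, |x j| ^ (2 * κ j)) := by
  fun_prop

instance : SigmaFinite (muK d κ) := by
  unfold muK
  infer_instance

theorem muK_pi_le (hκ : ∀ j, 0 < κ j) {S : Fin d → Set ℝ} (hS : ∀ j, MeasurableSet (S j))
    {M : Fin d → ℝ} (hM : ∀ j, ∀ t ∈ S j, |t| ≤ M j) :
    muK d κ (univ.pi S) ≤ ENNReal.ofReal (∏ j, M j ^ (2 * κ j)) * ∏ j, volume (S j) := by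
  rw [muK, withDensity_apply _ (MeasurableSet.univ_pi hS), ← volume_pi_pi, ← setLIntegral_const]
  refine setLIntegral_mono measurable_const fun x hx => ENNReal.ofReal_le_ofReal ?_
  refine Finset.prod_le_prod (fun j _ => by positivity) fun j _ => ?_
  exact rpow_le_rpow (abs_nonneg _) (hM j _ (hx j trivial)) (by linarith [hκ j])

theorem le_muK_pi (hκ : ∀ j, 0 < κ j) {S : Fin d → Set ℝ} (hS : ∀ j, MeasurableSet (S j))
    {M : Fin d → ℝ} (hM0 : ∀ j, 0 ≤ M j) (hM : ∀ j, ∀ t ∈ S j, M j ≤ |t|) :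
    ENNReal.ofReal (∏ j, M j ^ (2 * κ j)) * ∏ j, volume (S j) ≤ muK d κ (univ.pi S) := by
  rw [muK, withDensity_apply _ (MeasurableSet.univ_pi hS), ← volume_pi_pi, ← setLIntegral_const]
  refine setLIntegral_mono (measurable_muK_density d κ) fun x hx => ENNReal.ofReal_le_ofReal ?_
  refine Finset.prod_le_prod (fun j _ => rpow_nonneg (hM0 j) _) fun j _ => ?_
  exact rpow_le_rpow (hM0 j) (hM j _ (hx j trivial)) (by linarith [hκ j])

/-- The points whose coordinatewise absolute values lie in the open cube of radius `q` around
`(|c_1|, …, |c_d|)`. -/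
def foldBox (c : Fin d → ℝ) (q : ℝ) : Set (Fin d → ℝ) :=
  univ.pi fun j => {t | |(|t| - |c j|)| < q}

theorem mem_foldBox {c y : Fin d → ℝ} {q : ℝ} : y ∈ foldBox c q ↔ ∀ j, |(|y j| - |c j|)| < q := by
  simp [foldBox]

theorem measurableSet_fold (c q : ℝ) : MeasurableSet {t : ℝ | |(|t| - |c|)| < q} :=
  measurableSet_lt (by fun_prop) measurable_const

theorem volume_fold_le (c q : ℝ) :
    volume {t : ℝ | |(|t| - |c|)| < q} ≤ ENNReal.ofReal (4 * q) := by
  rcases le_or_gt q 0 with hq | hq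
  · rw [show {t : ℝ | |(|t| - |c|)| < q} = ∅ from
      eq_empty_of_forall_notMem fun t ht => absurd (lt_of_lt_of_le ht hq) (abs_nonneg _).not_gt]
    simp
  calc volume {t : ℝ | |(|t| - |c|)| < q}
      ≤ volume (Ioo (|c| - q) (|c| + q) ∪ Ioo (-|c| - q) (-|c| + q)) := by
        refine measure_mono fun t ht => ?_
        have h := abs_lt.1 (show |(|t| - |c|)| < q from ht)
        rcases abs_cases t with ⟨h1, -⟩ | ⟨h1, -⟩
        · left; constructor <;> linarith [h.1, h.2]
        · right; constructor <;> linarith [h.1, h.2]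
    _ ≤ volume (Ioo (|c| - q) (|c| + q)) + volume (Ioo (-|c| - q) (-|c| + q)) :=
        measure_union_le _ _
    _ = ENNReal.ofReal (4 * q) := by
        rw [Real.volume_Ioo, Real.volume_Ioo, ← ENNReal.ofReal_add (by linarith) (by linarith)]
        congr 1; ring

/-- The size of `μ_κ` on a folded box, up to constants. -/
def foldWeight (κ c : Fin d → ℝ) (q : ℝ) : ℝ := ∏ j, (q * (|c j| + q) ^ (2 * κ j))

theorem foldWeight_pos (κ c : Fin d → ℝ) {q : ℝ} (hq : 0 < q) : 0 < foldWeight κ c q :=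
  Finset.prod_pos fun j _ => by positivity

theorem muK_foldBox_le (hκ : ∀ j, 0 < κ j) (c : Fin d → ℝ) {q : ℝ} (hq : 0 < q) :
    muK d κ (foldBox c q) ≤ ENNReal.ofReal (4 ^ d * foldWeight κ c q) := by
  refine (muK_pi_le hκ (fun j => measurableSet_fold _ _) (M := fun j => |c j| + q)
    fun j t ht => ?_).trans ?_
  · have := (abs_lt.1 (show |(|t| - |c j|)| < q from ht)).2
    linarith
  · calc _ ≤ ENNReal.ofReal (∏ j, (|c j| + q) ^ (2 * κ j)) * ∏ _j : Fin d, ENNReal.ofReal (4 * q) :=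
          mul_le_mul' le_rfl (Finset.prod_le_prod' fun j _ => volume_fold_le _ _)
      _ = _ := by
          rw [Finset.prod_const, ← ENNReal.ofReal_pow (by linarith), ← ENNReal.ofReal_mul
            (Finset.prod_nonneg fun j _ => by positivity), foldWeight, Finset.prod_mul_distrib]
          congr 1
          simp only [Finset.prod_const, Finset.card_univ, Fintype.card_fin]
          ring

theorem le_muK_foldBox (hκ : ∀ j, 0 < κ j) (c : Fin d → ℝ) {q : ℝ} (hq : 0 < q) :
    ENNReal.ofReal ((∏ j, (2⁻¹ * 2⁻¹ ^ (2 * κ j))) * foldWeight κ c q) ≤ muK d κ (foldBox c q) := by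
  have hsub : (univ.pi fun j => Ioo (|c j| + q / 2) (|c j| + q)) ⊆ foldBox c q := by
    intro y hy
    rw [mem_foldBox]
    intro j
    have h := hy j trivial
    have h0 : 0 < y j := by linarith [h.1, abs_nonneg (c j)]
    rw [abs_of_pos h0, abs_lt]
    constructor <;> linarith [h.1, h.2]
  refine le_trans ?_ ((le_muK_pi hκ (fun j => measurableSet_Ioo)
    (M := fun j => 2⁻¹ * (|c j| + q)) (fun j => by positivity) fun j t ht => ?_).trans
    (measure_mono hsub))
  · simp only [Real.volume_Ioo]
    rw [← ENNReal.ofReal_prod_of_nonneg (fun j _ => by linarith), ← ENNReal.ofReal_mul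
      (Finset.prod_nonneg fun j _ => by positivity), foldWeight, ← Finset.prod_mul_distrib,
      ← Finset.prod_mul_distrib]
    refine ENNReal.ofReal_le_ofReal (le_of_eq (Finset.prod_congr rfl fun j _ => ?_))
    rw [Real.mul_rpow (by norm_num) (by positivity)]
    ring
  · have h0 : 0 < t := by linarith [ht.1, abs_nonneg (c j)]
    rw [abs_of_pos h0]
    linarith [ht.1, abs_nonneg (c j)]

theorem muK_foldBox_ne_top (hκ : ∀ j, 0 < κ j) (c : Fin d → ℝ) {q : ℝ} (hq : 0 < q) :
    muK d κ (foldBox c q) ≠ ∞ :=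
  ne_top_of_le_ne_top ENNReal.ofReal_ne_top (muK_foldBox_le hκ c hq)

theorem muK_foldBox_ne_zero (hκ : ∀ j, 0 < κ j) (c : Fin d → ℝ) {q : ℝ} (hq : 0 < q) :
    muK d κ (foldBox c q) ≠ 0 := by
  refine (lt_of_lt_of_le (ENNReal.ofReal_pos.2 ?_) (le_muK_foldBox hκ c hq)).ne'
  exact mul_pos (Finset.prod_pos fun j _ => by positivity) (foldWeight_pos κ c hq)

theorem foldWeight_mul_le (hκ : ∀ j, 0 < κ j) (c c' : Fin d → ℝ) {q t : ℝ} (hq : 0 < q)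
    (ht : 0 < t) (h : ∀ j, |c' j| + t * q ≤ t * (|c j| + q)) :
    foldWeight κ c' (t * q) ≤ (∏ j, (t * t ^ (2 * κ j))) * foldWeight κ c q := by
  rw [foldWeight, foldWeight, ← Finset.prod_mul_distrib]
  refine Finset.prod_le_prod (fun j _ => by positivity) fun j _ => ?_
  calc t * q * (|c' j| + t * q) ^ (2 * κ j) ≤ t * q * (t * (|c j| + q)) ^ (2 * κ j) := by
        gcongr
        · linarith [hκ j]
        · exact h j
    _ = _ := by rw [Real.mul_rpow ht.le (by positivity)]; ring

theorem exists_muK_foldBox_le (hκ : ∀ j, 0 < κ j) {t : ℝ} (ht : 1 ≤ t) :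
    ∃ D : ℝ≥0, ∀ (c : Fin d → ℝ) (q : ℝ), 0 < q →
      muK d κ (foldBox c (t * q)) ≤ D * muK d κ (foldBox c q) := by
  set a : ℝ := ∏ j, (2⁻¹ * 2⁻¹ ^ (2 * κ j)) with ha
  have ha0 : 0 < a := Finset.prod_pos fun j _ => by positivity
  set b : ℝ := ∏ j, (t * t ^ (2 * κ j)) with hb
  refine ⟨(4 ^ d * b / a).toNNReal, fun c q hq => ?_⟩
  have hb0 : 0 ≤ 4 ^ d * b / a := by
    have : 0 ≤ b := Finset.prod_nonneg fun j _ => by positivity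
    positivity
  calc muK d κ (foldBox c (t * q)) ≤ ENNReal.ofReal (4 ^ d * foldWeight κ c (t * q)) :=
        muK_foldBox_le hκ c (by positivity)
    _ ≤ ENNReal.ofReal (4 ^ d * b / a * (a * foldWeight κ c q)) := by
        refine ENNReal.ofReal_le_ofReal ?_
        rw [div_mul_eq_mul_div, mul_left_comm, mul_div_cancel_left₀ _ ha0.ne', mul_assoc]
        refine mul_le_mul_of_nonneg_left (foldWeight_mul_le hκ c c hq (by linarith) fun j => ?_)
          (by positivity)
        nlinarith [abs_nonneg (c j)]
    _ = ENNReal.ofReal (4 ^ d * b / a) * ENNReal.ofReal (a * foldWeight κ c q) :=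
        ENNReal.ofReal_mul hb0
    _ ≤ _ := mul_le_mul' le_rfl (le_muK_foldBox hκ c hq)

/-- The folded boxes with rational centre and radius. -/
def ratBox (d : ℕ) (i : (Fin d → ℚ) × {q : ℚ // 0 < q}) : Set (Fin d → ℝ) :=
  foldBox (fun j => (i.1 j : ℝ)) (i.2 : ℚ)

/-- The index of the fivefold enlargement of a folded box. -/
def ratStar (d : ℕ) (i : (Fin d → ℚ) × {q : ℚ // 0 < q}) : (Fin d → ℚ) × {q : ℚ // 0 < q} :=
  (i.1, ⟨5 * i.2, mul_pos (by norm_num) i.2.2⟩)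

theorem vitaliBasis_ratBox (d : ℕ) :
    VitaliBasis (ratBox d) (ratStar d) (fun i => ((i.2 : ℚ) : ℝ)) where
  measurableSet i := MeasurableSet.univ_pi fun j => measurableSet_fold _ _
  size_nonneg i := by exact_mod_cast i.2.2.le
  engulf i j h hij := by
    obtain ⟨z, hzi, hzj⟩ := h
    intro y hy
    rw [ratBox, mem_foldBox] at hzi hzj hy ⊢
    intro k
    have h1 := abs_lt.1 (hzi k)
    have h2 := abs_lt.1 (hzj k)
    have h3 := abs_lt.1 (hy k)
    simp only [ratStar, Rat.cast_mul, Rat.cast_ofNat]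
    rw [abs_lt]
    constructor <;> linarith [h1.1, h1.2, h2.1, h2.2, h3.1, h3.2]

theorem vector_valued_maxOp_ratBox (hκ : ∀ j, 0 < κ j) {r p : ℝ} (hr : 1 < r) (hp : 1 < p) :
    ∃ C : ℝ≥0, ∀ F : ℕ → (Fin d → ℝ) → ℝ≥0∞, (∀ n, Measurable (F n)) →
      ∫⁻ x, (∑' n, F n x ^ r) ^ (p / r) ∂(muK d κ) ≠ ∞ →
      ∫⁻ x, (∑' n, maxOp (ratBox d) (muK d κ) (F n) x ^ r) ^ (p / r) ∂(muK d κ) ≤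
        C * ∫⁻ x, (∑' n, F n x ^ r) ^ (p / r) ∂(muK d κ) := by
  obtain ⟨D, hD⟩ := exists_muK_foldBox_le hκ (t := 5) (by norm_num)
  have hpos : ∀ i : (Fin d → ℚ) × {q : ℚ // 0 < q}, (0 : ℝ) < (i.2 : ℚ) := fun i => by
    exact_mod_cast i.2.2
  refine vector_valued_maxOp (vitaliBasis_ratBox d)
    (fun i => muK_foldBox_ne_zero hκ _ (hpos i)) (fun i => muK_foldBox_ne_top hκ _ (hpos i))
    (D := D) (fun i => ?_) hr hp
  have := hD (fun j => (i.1 j : ℝ)) (i.2 : ℚ) (hpos i)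
  simpa [ratBox, ratStar] using this

end FoldedBoxes

section KernelEstimate

variable {κ x y z : ℝ}

theorem lintegral_Ioo_eq_of_hasDerivAt {F f : ℝ → ℝ} {a b : ℝ} (hab : a ≤ b)
    (hc : ContinuousOn F (Icc a b)) (hd : ∀ t ∈ Ioo a b, HasDerivAt F (f t) t)
    (hf : ∀ t ∈ Ioo a b, 0 ≤ f t) :
    ∫⁻ t in Ioo a b, ENNReal.ofReal (f t) = ENNReal.ofReal (F b - F a) := by
  have hi : IntegrableOn f (Ioc a b) :=
    intervalIntegral.integrableOn_deriv_of_nonneg hc hd hf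
  rw [← intervalIntegral.integral_eq_sub_of_hasDerivAt_of_le hab hc hd
    ((intervalIntegrable_iff_integrableOn_Ioc_of_le hab).2 hi), intervalIntegral.integral_of_le hab,
    integral_Ioc_eq_integral_Ioo, ofReal_integral_eq_lintegral_ofReal]
  · exact hi.mono_set Ioo_subset_Ioc_self
  · exact (ae_restrict_iff' measurableSet_Ioo).2 (ae_of_all _ hf)

theorem lintegral_mul_sq_sub_rpow (hκ : 0 < κ) {A u v : ℝ} (hu : 0 ≤ u) (hA : A = u ^ 2)
    (huv : u ≤ v) :
    ∫⁻ t in Ioo u v, ENNReal.ofReal (t * (t ^ 2 - A) ^ (κ - 1)) =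
      ENNReal.ofReal ((v ^ 2 - A) ^ κ / (2 * κ)) := by
  rw [lintegral_Ioo_eq_of_hasDerivAt (F := fun t => (t ^ 2 - A) ^ κ / (2 * κ)) huv]
  · simp [hA, hκ.ne']
  · refine Continuous.continuousOn (Continuous.div_const ?_ _)
    exact Continuous.rpow_const (by fun_prop) fun _ => Or.inr hκ.le
  · intro t ht
    have hpos : 0 < t ^ 2 - A := by rw [hA]; nlinarith [ht.1]
    have h1 : HasDerivAt (fun t : ℝ => t ^ 2 - A) (2 * t) t := by
      simpa using (hasDerivAt_pow 2 t).sub_const A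
    have h := (h1.rpow_const (p := κ) (Or.inl hpos.ne')).div_const (2 * κ)
    refine h.congr_deriv ?_
    field_simp
  · intro t ht
    exact mul_nonneg (by linarith [ht.1]) (rpow_nonneg (by rw [hA]; nlinarith [ht.1]) _)

theorem lintegral_mul_sub_sq_rpow (hκ : 0 < κ) {A u v : ℝ} (hu : 0 ≤ u) (hA : A = v ^ 2)
    (huv : u ≤ v) :
    ∫⁻ t in Ioo u v, ENNReal.ofReal (t * (A - t ^ 2) ^ (κ - 1)) =
      ENNReal.ofReal ((A - u ^ 2) ^ κ / (2 * κ)) := by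
  rw [lintegral_Ioo_eq_of_hasDerivAt (F := fun t => -((A - t ^ 2) ^ κ / (2 * κ))) huv]
  · simp [hA, hκ.ne']
  · refine Continuous.continuousOn (Continuous.neg (Continuous.div_const ?_ _))
    exact Continuous.rpow_const (by fun_prop) fun _ => Or.inr hκ.le
  · intro t ht
    have hpos : 0 < A - t ^ 2 := by rw [hA]; nlinarith [ht.1, ht.2]
    have h1 : HasDerivAt (fun t : ℝ => A - t ^ 2) (-(2 * t)) t := by
      simpa using (hasDerivAt_pow 2 t).const_sub A
    have h := ((h1.rpow_const (p := κ) (Or.inl hpos.ne')).div_const (2 * κ)).neg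
    refine h.congr_deriv ?_
    field_simp
  · intro t ht
    exact mul_nonneg (by linarith [ht.1]) (rpow_nonneg (by rw [hA]; nlinarith [ht.1, ht.2]) _)

theorem Mconst_pos (hκ : 0 < κ) : 0 < Mconst κ :=
  div_pos (Gamma_pos_of_pos (by linarith))
    (mul_pos (Gamma_pos_of_pos hκ) (Gamma_pos_of_pos (by norm_num)))

theorem nuDens_neg (κ x y z : ℝ) : nuDens κ x y (-z) = nuDens κ x y z := by
  simp [nuDens, sigma3]

theorem nuDens_eq_zero (h : |z| < |(|x| - |y|)| ∨ |x| + |y| < |z|) : nuDens κ x y z = 0 := by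
  have : ¬(|(|x| - |y|)| ≤ |z| ∧ |z| ≤ |x| + |y|) := by
    rintro ⟨h1, h2⟩
    rcases h with h | h <;> linarith
  simp [nuDens, Kker, this]

theorem neg_one_le_sigma3 (h1 : (|x| - |y|) ^ 2 ≤ z ^ 2) (h2 : z ^ 2 ≤ (|x| + |y|) ^ 2) :
    -1 ≤ sigma3 x y z := by
  unfold sigma3
  split_ifs with hxy
  · have hpos : 0 < 2 * (|x| * |y|) := by
      have := abs_pos.2 hxy.1
      have := abs_pos.2 hxy.2
      positivity
    refine neg_le_of_abs_le ?_
    have habs : |2 * x * y| = 2 * (|x| * |y|) := by rw [abs_mul, abs_mul]; simp [mul_assoc]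
    rw [abs_div, habs, div_le_one hpos, abs_le]
    constructor <;> nlinarith [sq_abs x, sq_abs y]
  · norm_num

/-- The constant in the pointwise bound for the translation kernel. -/
def kerConst (κ : ℝ) : ℝ := 2 ^ (2 * κ - 2) * Mconst κ * 16⁻¹ ^ (κ - 1)

theorem kerConst_pos (hκ : 0 < κ) : 0 < kerConst κ := by
  have := Mconst_pos hκ
  unfold kerConst
  positivity

theorem nuDens_le (hκ : 0 < κ) (hx : x ≠ 0) (hy : y ≠ 0) (hz : 0 < z)
    (h1 : (|x| - |y|) ^ 2 < z ^ 2) (h2 : z ^ 2 < (|x| + |y|) ^ 2) :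
    nuDens κ x y z ≤ ENNReal.ofReal (kerConst κ * (|x| * |y|) ^ (1 - 2 * κ) *
      (z * ((z ^ 2 - (|x| - |y|) ^ 2) ^ (κ - 1) * ((|x| + |y|) ^ 2 - z ^ 2) ^ (κ - 1)))) := by
  have ha := abs_pos.2 hx
  have hb := abs_pos.2 hy
  have hσ := neg_one_le_sigma3 h1.le h2.le
  have hM := Mconst_pos hκ
  refine ENNReal.ofReal_le_ofReal ?_
  have hcond : |(|x| - |y|)| ≤ z ∧ z ≤ |x| + |y| :=
    ⟨(abs_lt_of_sq_lt_sq h1 hz.le).le, (lt_of_pow_lt_pow_left₀ 2 (by positivity) h2).le⟩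
  have hA : 0 < z ^ 2 - (|x| - |y|) ^ 2 := by linarith
  have hQ : 0 < (|x| + |y|) ^ 2 - z ^ 2 := by linarith
  have hT : triArea |x| |y| z ^ (2 * κ - 2) = 16⁻¹ ^ (κ - 1) *
      ((z ^ 2 - (|x| - |y|) ^ 2) ^ (κ - 1) * ((|x| + |y|) ^ 2 - z ^ 2) ^ (κ - 1)) := by
    rw [← Real.mul_rpow hA.le hQ.le, ← Real.mul_rpow (by norm_num) (mul_pos hA hQ).le, triArea,
      Real.sqrt_eq_rpow, ← Real.rpow_mul]
    · congr 1 <;> ring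
    · have : 0 ≤ 16⁻¹ * ((z ^ 2 - (|x| - |y|) ^ 2) * ((|x| + |y|) ^ 2 - z ^ 2)) := by positivity
      convert this using 1
      ring
  have hz2 : z ^ (1 - 2 * κ) * z ^ (2 * κ) = z := by
    rw [← Real.rpow_add hz, sub_add_cancel, Real.rpow_one]
  rw [abs_of_pos hz, Kker, if_pos hcond, hT, Real.mul_rpow (by positivity) hz.le]
  set P := (z ^ 2 - (|x| - |y|) ^ 2) ^ (κ - 1) * ((|x| + |y|) ^ 2 - z ^ 2) ^ (κ - 1) with hP
  have hP0 : 0 ≤ P := by positivity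
  calc _ = (1 - sigma3 x y z) / 2 * (kerConst κ * (|x| * |y|) ^ (1 - 2 * κ) *
        ((z ^ (1 - 2 * κ) * z ^ (2 * κ)) * P)) := by unfold kerConst; ring
    _ ≤ 1 * (kerConst κ * (|x| * |y|) ^ (1 - 2 * κ) * ((z ^ (1 - 2 * κ) * z ^ (2 * κ)) * P)) := by
        have := kerConst_pos hκ
        refine mul_le_mul_of_nonneg_right (by linarith) (by positivity)
    _ = _ := by rw [hz2, one_mul]

theorem rpow_le_of_mem_Icc {a b t s : ℝ} (ha : 0 < a) (hat : a ≤ t) (htb : t ≤ b) :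
    t ^ s ≤ a ^ s + b ^ s := by
  have ht : 0 < t := ha.trans_le hat
  have hb : 0 < b := ht.trans_le htb
  rcases le_total 0 s with h | h
  · linarith [rpow_le_rpow ht.le htb h, rpow_pos_of_pos ha s]
  · linarith [rpow_le_rpow_of_nonpos ha hat h, rpow_pos_of_pos hb s]

/-- The constant in the one-sided bounds for the translation kernel. -/
def halfConst (κ : ℝ) : ℝ := kerConst κ * (2 ^ (κ - 1) + 4 ^ (κ - 1))

theorem halfConst_pos (hκ : 0 < κ) : 0 < halfConst κ := by
  have := kerConst_pos hκ
  unfold halfConst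
  positivity

theorem kerConst_mul_le (hκ : 0 < κ) {m t u v : ℝ} (hm : 0 < m) (hv : 0 ≤ v)
    (hu : 2 * m ≤ u) (hu' : u ≤ 4 * m) (ht : 0 ≤ t) :
    kerConst κ * m ^ (1 - 2 * κ) * (t * (v * u ^ (κ - 1))) ≤ halfConst κ * m ^ (-κ) * (t * v) := by
  have := kerConst_pos hκ
  have h := rpow_le_of_mem_Icc (s := κ - 1) (by positivity) hu hu'
  rw [Real.mul_rpow (by norm_num) hm.le, Real.mul_rpow (by norm_num) hm.le] at h
  have hm2 : m ^ (-κ) = m ^ (1 - 2 * κ) * m ^ (κ - 1) := by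
    rw [← Real.rpow_add hm]; congr 1; ring
  calc kerConst κ * m ^ (1 - 2 * κ) * (t * (v * u ^ (κ - 1)))
      ≤ kerConst κ * m ^ (1 - 2 * κ) *
        (t * (v * (2 ^ (κ - 1) * m ^ (κ - 1) + 4 ^ (κ - 1) * m ^ (κ - 1)))) := by gcongr
    _ = _ := by rw [hm2]; unfold halfConst; ring

theorem nuDens_le_lower (hκ : 0 < κ) (hx : x ≠ 0) (hy : y ≠ 0) (hz : 0 < z)
    (h1 : (|x| - |y|) ^ 2 < z ^ 2) (h2 : z ^ 2 ≤ |x| ^ 2 + |y| ^ 2) :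
    nuDens κ x y z ≤ ENNReal.ofReal (halfConst κ * (|x| * |y|) ^ (-κ)) *
      ENNReal.ofReal (z * (z ^ 2 - (|x| - |y|) ^ 2) ^ (κ - 1)) := by
  have hm : 0 < |x| * |y| := mul_pos (abs_pos.2 hx) (abs_pos.2 hy)
  have := halfConst_pos hκ
  rw [← ENNReal.ofReal_mul (by positivity)]
  refine (nuDens_le hκ hx hy hz h1 (by nlinarith)).trans (ENNReal.ofReal_le_ofReal ?_)
  exact kerConst_mul_le hκ hm (rpow_nonneg (by linarith) _) (by nlinarith) (by nlinarith) hz.le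

theorem nuDens_le_upper (hκ : 0 < κ) (hx : x ≠ 0) (hy : y ≠ 0) (hz : 0 < z)
    (h1 : |x| ^ 2 + |y| ^ 2 ≤ z ^ 2) (h2 : z ^ 2 < (|x| + |y|) ^ 2) :
    nuDens κ x y z ≤ ENNReal.ofReal (halfConst κ * (|x| * |y|) ^ (-κ)) *
      ENNReal.ofReal (z * ((|x| + |y|) ^ 2 - z ^ 2) ^ (κ - 1)) := by
  have hm : 0 < |x| * |y| := mul_pos (abs_pos.2 hx) (abs_pos.2 hy)
  have := halfConst_pos hκ
  rw [← ENNReal.ofReal_mul (by positivity)]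
  refine (nuDens_le hκ hx hy hz (by nlinarith) h2).trans (ENNReal.ofReal_le_ofReal ?_)
  rw [mul_comm ((z ^ 2 - _) ^ (κ - 1))]
  exact kerConst_mul_le hκ hm (rpow_nonneg (by linarith) _) (by nlinarith) (by nlinarith) hz.le

theorem lintegral_nuDens_lower (hκ : 0 < κ) (hx : x ≠ 0) (hy : y ≠ 0) {s : ℝ}
    (h1 : |(|x| - |y|)| ≤ s) (h2 : s ^ 2 ≤ |x| ^ 2 + |y| ^ 2) :
    ∫⁻ t in Ioo |(|x| - |y|)| s, nuDens κ x y t ≤ ENNReal.ofReal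
      (halfConst κ * (|x| * |y|) ^ (-κ) * ((s ^ 2 - (|x| - |y|) ^ 2) ^ κ / (2 * κ))) := by
  have hm : 0 < |x| * |y| := mul_pos (abs_pos.2 hx) (abs_pos.2 hy)
  have := halfConst_pos hκ
  rw [ENNReal.ofReal_mul (by positivity),
    ← lintegral_mul_sq_sub_rpow hκ (abs_nonneg _) (sq_abs _).symm h1,
    ← lintegral_const_mul' _ _ ENNReal.ofReal_ne_top]
  refine setLIntegral_mono' measurableSet_Ioo fun t ht => ?_
  have ht0 : 0 < t := (abs_nonneg _).trans_lt ht.1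
  exact nuDens_le_lower hκ hx hy ht0 (sq_lt_sq.2 (by rw [abs_of_pos ht0]; exact ht.1))
    ((pow_le_pow_left₀ ht0.le ht.2.le 2).trans h2)

theorem lintegral_nuDens_upper (hκ : 0 < κ) (hx : x ≠ 0) (hy : y ≠ 0) {s : ℝ} (hs : 0 ≤ s)
    (h1 : s ≤ |x| + |y|) (h2 : |x| ^ 2 + |y| ^ 2 ≤ s ^ 2) :
    ∫⁻ t in Ioo s (|x| + |y|), nuDens κ x y t ≤ ENNReal.ofReal
      (halfConst κ * (|x| * |y|) ^ (-κ) * (((|x| + |y|) ^ 2 - s ^ 2) ^ κ / (2 * κ))) := by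
  have hm : 0 < |x| * |y| := mul_pos (abs_pos.2 hx) (abs_pos.2 hy)
  have := halfConst_pos hκ
  rw [ENNReal.ofReal_mul (by positivity), ← lintegral_mul_sub_sq_rpow hκ hs rfl h1,
    ← lintegral_const_mul' _ _ ENNReal.ofReal_ne_top]
  refine setLIntegral_mono' measurableSet_Ioo fun t ht => ?_
  have ht0 : 0 < t := hs.trans_lt ht.1
  exact nuDens_le_upper hκ hx hy ht0 (h2.trans (pow_le_pow_left₀ hs ht.1.le 2))
    (pow_lt_pow_left₀ ht.2 ht0.le two_ne_zero)

theorem lintegral_nuDens_symm (κ x y r : ℝ) :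
    ∫⁻ t in Ioo (-r) r, nuDens κ x y t ≤ 2 * ∫⁻ t in Ioo 0 r, nuDens κ x y t := by
  have hneg : ∫⁻ t in Ioo (-r) 0, nuDens κ x y t = ∫⁻ t in Ioo 0 r, nuDens κ x y t := by
    have h := (Measure.measurePreserving_neg (volume : Measure ℝ)).setLIntegral_comp_preimage_emb
      (MeasurableEquiv.neg ℝ).measurableEmbedding (nuDens κ x y) (Ioo 0 r)
    simpa [nuDens_neg] using h
  have hsub : Ioo (-r) r ≤ᵐ[volume] (Ioo (-r) 0 ∪ Ioo 0 r : Set ℝ) := by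
    filter_upwards [Measure.ae_ne volume (0 : ℝ)] with t ht0 ht
    rcases lt_or_gt_of_ne ht0 with h | h
    · exact Or.inl ⟨ht.1, h⟩
    · exact Or.inr ⟨h, ht.2⟩
  calc ∫⁻ t in Ioo (-r) r, nuDens κ x y t
      ≤ ∫⁻ t in Ioo (-r) 0 ∪ Ioo 0 r, nuDens κ x y t :=
        lintegral_mono' (Measure.restrict_mono_ae hsub) le_rfl
    _ ≤ _ := lintegral_union_le _ _ _
    _ = _ := by rw [hneg, two_mul]

theorem lintegral_nuDens_eq_zero {r : ℝ} (h : r ≤ |(|x| - |y|)|) :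
    ∫⁻ t in Ioo (-r) r, nuDens κ x y t = 0 := by
  rw [setLIntegral_congr_fun measurableSet_Ioo fun t ht =>
    nuDens_eq_zero (Or.inl ((abs_lt.2 ht).trans_le h))]
  simp

/-- The near-origin mass of the translation kernel in dimension one. -/
theorem exists_lintegral_nuDens_le (hκ : 0 < κ) :
    ∃ C : ℝ, 0 < C ∧ ∀ x y r : ℝ, x ≠ 0 → y ≠ 0 → 0 < r →
      ∫⁻ t in Ioo (-r) r, nuDens κ x y t ≤ ENNReal.ofReal (C * (r / (|x| + r)) ^ (2 * κ)) := by
  have hc := halfConst_pos hκ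
  refine ⟨2 * (halfConst κ * 8 ^ κ / (2 * κ) + 2 * (halfConst κ * 2 ^ κ / (2 * κ)) * 3 ^ (2 * κ)),
    by positivity, fun x y r hx hy hr => ?_⟩
  have ha := abs_pos.2 hx
  have hb := abs_pos.2 hy
  set a := |x| with hadef
  set b := |y| with hbdef
  have hab : 0 < a * b := mul_pos ha hb
  rcases le_or_gt r |a - b| with hrab | hrab
  · rw [lintegral_nuDens_eq_zero hrab]; exact zero_le
  refine (lintegral_nuDens_symm κ x y r).trans ?_
  rw [mul_assoc, ENNReal.ofReal_mul zero_le_two, ENNReal.ofReal_ofNat]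
  refine mul_le_mul' le_rfl ?_
  rw [add_mul]
  rcases lt_or_ge r (a / 2) with hra | hra
  · have hb2 : a / 2 ≤ b := by linarith [(abs_lt.1 hrab).2]
    refine le_trans ?_ (ENNReal.ofReal_le_ofReal (le_add_of_nonneg_right (by positivity)))
    have hsub : Ioo 0 r ≤ᵐ[volume] (Ioo 0 |a - b| ∪ Ioo |a - b| r : Set ℝ) := by
      filter_upwards [Measure.ae_ne volume |a - b|] with t ht0 ht
      rcases lt_or_gt_of_ne ht0 with h | h
      · exact Or.inl ⟨ht.1, h⟩
      · exact Or.inr ⟨h, ht.2⟩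
    have hz : ∫⁻ t in Ioo 0 |a - b|, nuDens κ x y t = 0 := by
      rw [setLIntegral_congr_fun measurableSet_Ioo fun t ht =>
        nuDens_eq_zero (Or.inl (by rw [abs_of_pos ht.1]; exact ht.2))]
      simp
    calc ∫⁻ t in Ioo 0 r, nuDens κ x y t
        ≤ ∫⁻ t in Ioo 0 |a - b| ∪ Ioo |a - b| r, nuDens κ x y t :=
          lintegral_mono' (Measure.restrict_mono_ae hsub) le_rfl
      _ ≤ _ := lintegral_union_le _ _ _
      _ = ∫⁻ t in Ioo |a - b| r, nuDens κ x y t := by rw [hz, zero_add]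
      _ ≤ ENNReal.ofReal (halfConst κ * (a * b) ^ (-κ) * ((r ^ 2 - (a - b) ^ 2) ^ κ / (2 * κ))) :=
          lintegral_nuDens_lower hκ hx hy hrab.le (by nlinarith)
      _ ≤ _ := by
          refine ENNReal.ofReal_le_ofReal ?_
          have hsq : 0 ≤ r ^ 2 - (a - b) ^ 2 := by
            have := sq_le_sq.2 (show |a - b| ≤ |r| by rw [abs_of_pos hr]; exact hrab.le)
            linarith
          have hkey : (a * b) ^ (-κ) * (r ^ 2 - (a - b) ^ 2) ^ κ ≤
              8 ^ κ * (r / (a + r)) ^ (2 * κ) := by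
            rw [Real.rpow_neg hab.le, ← Real.inv_rpow hab.le, Real.rpow_mul (by positivity),
              Real.rpow_two, ← Real.mul_rpow (by positivity) hsq,
              ← Real.mul_rpow (by norm_num) (by positivity)]
            refine rpow_le_rpow (by positivity) ?_ hκ.le
            rw [inv_mul_le_iff₀ hab, div_pow]
            have h8 : r ^ 2 ≤ a * b * (8 * (r ^ 2 / (a + r) ^ 2)) := by
              rw [show a * b * (8 * (r ^ 2 / (a + r) ^ 2)) = r ^ 2 * (8 * (a * b) / (a + r) ^ 2) by
                ring]
              refine le_mul_of_one_le_right (by positivity) ?_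
              rw [one_le_div (by positivity)]
              nlinarith
            nlinarith [sq_nonneg (a - b)]
          calc _ = halfConst κ / (2 * κ) * ((a * b) ^ (-κ) * (r ^ 2 - (a - b) ^ 2) ^ κ) := by ring
            _ ≤ halfConst κ / (2 * κ) * (8 ^ κ * (r / (a + r)) ^ (2 * κ)) := by gcongr
            _ = _ := by ring
  · refine le_trans ?_ (ENNReal.ofReal_le_ofReal (le_add_of_nonneg_left (by positivity)))
    set s := √(a ^ 2 + b ^ 2) with hs
    have hs0 : 0 ≤ s := Real.sqrt_nonneg _
    have hss : s ^ 2 = a ^ 2 + b ^ 2 := Real.sq_sqrt (by positivity)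
    have h1s : |a - b| ≤ s := Real.abs_le_sqrt (by nlinarith)
    have h2s : s ≤ a + b := Real.sqrt_le_iff.2 ⟨by positivity, by nlinarith⟩
    have hsub : Ioo 0 r ≤ᵐ[volume] (Ioo |a - b| s ∪ Ioo s (a + b) ∪
        {t | 0 < t ∧ (t < |a - b| ∨ a + b < t)} : Set ℝ) := by
      filter_upwards [Measure.ae_ne volume |a - b|, Measure.ae_ne volume s,
        Measure.ae_ne volume (a + b)] with t h1 h2 h3 ht
      rcases lt_or_gt_of_ne h1 with h1 | h1
      · exact Or.inr ⟨ht.1, Or.inl h1⟩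
      rcases lt_or_gt_of_ne h3 with h3 | h3
      · rcases lt_or_gt_of_ne h2 with h2 | h2
        · exact Or.inl (Or.inl ⟨h1, h2⟩)
        · exact Or.inl (Or.inr ⟨h2, h3⟩)
      · exact Or.inr ⟨ht.1, Or.inr h3⟩
    have hms : MeasurableSet {t : ℝ | 0 < t ∧ (t < |a - b| ∨ a + b < t)} :=
      measurableSet_Ioi.inter (measurableSet_Iio.union measurableSet_Ioi)
    have hz : ∫⁻ t in {t | 0 < t ∧ (t < |a - b| ∨ a + b < t)}, nuDens κ x y t = 0 := by
      rw [setLIntegral_congr_fun hms fun t ht =>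
        nuDens_eq_zero (by rw [abs_of_pos ht.1]; exact ht.2)]
      simp
    have hhalf : halfConst κ * (a * b) ^ (-κ) * ((2 * (a * b)) ^ κ / (2 * κ)) =
        halfConst κ * 2 ^ κ / (2 * κ) := by
      rw [Real.mul_rpow zero_le_two hab.le, Real.rpow_neg hab.le]
      have := (rpow_pos_of_pos hab κ).ne'
      field_simp
    calc ∫⁻ t in Ioo 0 r, nuDens κ x y t
        ≤ ∫⁻ t in Ioo |a - b| s ∪ Ioo s (a + b) ∪ {t | 0 < t ∧ (t < |a - b| ∨ a + b < t)},
            nuDens κ x y t := lintegral_mono' (Measure.restrict_mono_ae hsub) le_rfl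
      _ ≤ (∫⁻ t in Ioo |a - b| s, nuDens κ x y t) + (∫⁻ t in Ioo s (a + b), nuDens κ x y t) + 0 := by
          refine (lintegral_union_le _ _ _).trans ?_
          rw [hz]
          gcongr
          exact lintegral_union_le _ _ _
      _ ≤ ENNReal.ofReal (halfConst κ * 2 ^ κ / (2 * κ)) +
            ENNReal.ofReal (halfConst κ * 2 ^ κ / (2 * κ)) + 0 := by
          refine add_le_add (add_le_add ?_ ?_) le_rfl
          · refine (lintegral_nuDens_lower hκ hx hy h1s hss.le).trans_eq ?_
            rw [← hhalf, show s ^ 2 - (a - b) ^ 2 = 2 * (a * b) by rw [hss]; ring]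
          · refine (lintegral_nuDens_upper hκ hx hy hs0 h2s hss.ge).trans_eq ?_
            rw [← hhalf, show (a + b) ^ 2 - s ^ 2 = 2 * (a * b) by rw [hss]; ring]
      _ = ENNReal.ofReal (2 * (halfConst κ * 2 ^ κ / (2 * κ))) := by
          rw [add_zero, ← ENNReal.ofReal_add (by positivity) (by positivity),
            two_mul (halfConst κ * 2 ^ κ / (2 * κ))]
      _ ≤ _ := by
          refine ENNReal.ofReal_le_ofReal ?_
          rw [mul_assoc (2 * (halfConst κ * 2 ^ κ / (2 * κ))),
            ← Real.mul_rpow (by norm_num) (by positivity)]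
          refine le_mul_of_one_le_right (by positivity) (Real.one_le_rpow ?_ (by positivity))
          rw [mul_div_assoc', one_le_div (by positivity)]
          linarith

end KernelEstimate

section ProductKernel

theorem lintegral_fin_prod_eq {n : ℕ} {f : Fin n → ℝ → ℝ≥0∞} (hf : ∀ i, Measurable (f i)) :
    ∫⁻ x : Fin n → ℝ, ∏ i, f i (x i) = ∏ i, ∫⁻ t, f i t := by
  induction n with
  | zero => simp [volume_pi]
  | succ n ih =>
    have hm : Measurable fun x : Fin n → ℝ => ∏ i, f (Fin.succ i) (x i) :=
      Finset.measurable_fun_prod _ fun i _ => (hf _).comp (measurable_pi_apply i)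
    rw [← ((volume_preserving_piFinSuccAbove (fun _ => ℝ) 0).symm).lintegral_comp_emb
      (MeasurableEquiv.measurableEmbedding _)]
    simp_rw [MeasurableEquiv.piFinSuccAbove_symm_apply, Fin.insertNthEquiv,
      Fin.prod_univ_succ, Fin.insertNth_zero, Equiv.coe_fn_mk, Fin.cons_succ, Measure.volume_eq_prod,
      Fin.cons_zero]
    exact (lintegral_prod_mul (hf 0).aemeasurable hm.aemeasurable).trans
      (congrArg _ (ih fun i => hf _))

theorem measurable_nuDens (κ x y : ℝ) : Measurable (nuDens κ x y) := by
  have hk : Measurable fun z => Kker κ |x| |y| |z| := by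
    have h : MeasurableSet {z : ℝ | |(|x| - |y|)| ≤ |z| ∧ |z| ≤ |x| + |y|} :=
      (measurableSet_le measurable_const measurable_norm).inter
        (measurableSet_le measurable_norm measurable_const)
    unfold Kker triArea
    exact Measurable.ite h (by fun_prop) measurable_const
  have hs : Measurable fun z => sigma3 x y z := by
    unfold sigma3
    split_ifs <;> fun_prop
  unfold nuDens
  fun_prop

variable {d : ℕ} {κ : Fin d → ℝ}

theorem eBall_subset_pi {r : ℝ} (hr : 0 < r) : eBall d r ⊆ univ.pi fun _ => Ioo (-r) r := by
  intro x hx j _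
  refine abs_lt.1 (abs_lt_of_sq_lt_sq ?_ hr.le)
  exact (Finset.single_le_sum (f := fun j => x j ^ 2) (fun j _ => sq_nonneg _)
    (Finset.mem_univ j)).trans_lt hx

theorem upsilon_eBall_le (κ x y : Fin d → ℝ) {r : ℝ} (hr : 0 < r) :
    upsilon d κ x y (eBall d r) ≤ ∏ j, ∫⁻ t in Ioo (-r) r, nuDens (κ j) (x j) (y j) t := by
  have hbox : MeasurableSet (univ.pi fun _ : Fin d => Ioo (-r) r) :=
    MeasurableSet.univ_pi fun _ => measurableSet_Ioo
  refine (measure_mono (eBall_subset_pi hr)).trans ?_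
  rw [upsilon, withDensity_apply _ hbox, ← lintegral_indicator hbox]
  simp_rw [← lintegral_indicator measurableSet_Ioo]
  rw [← lintegral_fin_prod_eq fun j => (measurable_nuDens _ _ _).indicator measurableSet_Ioo]
  refine lintegral_mono (indicator_le' (fun z hz => ?_) fun z _ => bot_le)
  exact (Finset.prod_congr rfl fun j _ => (indicator_of_mem (hz j trivial) _).symm).le

theorem exists_upsilon_eBall_le (hκ : ∀ j, 0 < κ j) :
    ∃ C : ℝ, 0 < C ∧ ∀ x ∈ regSet d, ∀ y ∈ regSet d, ∀ r : ℝ, 0 < r →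
      upsilon d κ x (-y) (eBall d r) ≤
        ENNReal.ofReal (C * ∏ j, (r / (|x j| + r)) ^ (2 * κ j)) := by
  choose C hC0 hC using fun j => exists_lintegral_nuDens_le (hκ j)
  refine ⟨∏ j, C j, Finset.prod_pos fun j _ => hC0 j, fun x hx y hy r hr => ?_⟩
  rw [← Finset.prod_mul_distrib, ENNReal.ofReal_prod_of_nonneg fun j _ =>
    mul_nonneg (hC0 j).le (by positivity)]
  exact (upsilon_eBall_le κ x (-y) hr).trans
    (Finset.prod_le_prod' fun j _ => hC j _ _ _ (hx j) (neg_ne_zero.2 (hy j)) hr)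

theorem upsilon_eBall_eq_zero {x y : Fin d → ℝ} {r : ℝ} (hr : 0 < r) (h : y ∉ foldBox x r) :
    upsilon d κ x (-y) (eBall d r) = 0 := by
  rw [mem_foldBox] at h
  push Not at h
  obtain ⟨j, hj⟩ := h
  refine le_antisymm ((upsilon_eBall_le κ x (-y) hr).trans_eq ?_) zero_le
  refine Finset.prod_eq_zero (Finset.mem_univ j) (lintegral_nuDens_eq_zero ?_)
  rwa [Pi.neg_apply, abs_neg, abs_sub_comm]

theorem muK_eBall_ne_top (hκ : ∀ j, 0 < κ j) {r : ℝ} (hr : 0 < r) : muK d κ (eBall d r) ≠ ∞ := by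
  refine ne_top_of_le_ne_top (muK_foldBox_ne_top hκ 0 hr) (measure_mono fun x hx => ?_)
  rw [mem_foldBox]
  intro j
  simpa [abs_lt] using eBall_subset_pi hr hx j trivial

theorem exists_le_muK_eBall (hκ : ∀ j, 0 < κ j) :
    ∃ c : ℝ, 0 < c ∧ ∀ r : ℝ, 0 < r →
      c * ∏ j, (r * r ^ (2 * κ j)) ≤ (muK d κ (eBall d r)).toReal := by
  set t : ℝ := 1 / (d + 1) with ht
  have ht0 : 0 < t := by positivity
  refine ⟨∏ j, (2⁻¹ * 2⁻¹ ^ (2 * κ j) * (t * t ^ (2 * κ j))), Finset.prod_pos fun j _ => by positivity,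
    fun r hr => ?_⟩
  rw [← ENNReal.ofReal_le_iff_le_toReal (muK_eBall_ne_top hκ hr)]
  have htr : 0 < t * r := by positivity
  have hsub : foldBox (0 : Fin d → ℝ) (t * r) ⊆ eBall d r := by
    intro x hx
    rw [mem_foldBox] at hx
    have hx2 : ∀ j, x j ^ 2 ≤ (t * r) ^ 2 := fun j => by
      have := hx j
      simp only [Pi.zero_apply, abs_zero, sub_zero, abs_abs] at this
      exact sq_le_sq.2 (by rw [abs_of_pos htr]; exact this.le)
    calc ∑ j, x j ^ 2 ≤ ∑ _j : Fin d, (t * r) ^ 2 := Finset.sum_le_sum fun j _ => hx2 j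
      _ = d * t ^ 2 * r ^ 2 := by simp; ring
      _ < 1 * r ^ 2 := by
          refine mul_lt_mul_of_pos_right ?_ (by positivity)
          rw [ht, div_pow, one_pow, mul_one_div, div_lt_one (by positivity)]
          nlinarith [(Nat.cast_nonneg d : (0 : ℝ) ≤ d)]
      _ = r ^ 2 := one_mul _
  refine le_trans (ENNReal.ofReal_le_ofReal (le_of_eq ?_))
    ((le_muK_foldBox hκ 0 htr).trans (measure_mono hsub))
  rw [foldWeight, ← Finset.prod_mul_distrib, ← Finset.prod_mul_distrib]
  refine Finset.prod_congr rfl fun j _ => ?_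
  simp only [Pi.zero_apply, abs_zero, zero_add]
  rw [Real.mul_rpow ht0.le hr.le]
  ring

end ProductKernel

section PointwiseBound

variable {d : ℕ} {κ : Fin d → ℝ}

theorem measurableSet_regSet (d : ℕ) : MeasurableSet (regSet d) := by
  have : regSet d = ⋂ j, (fun x : Fin d → ℝ => x j) ⁻¹' {0}ᶜ := by
    ext x
    simp [regSet]
  rw [this]
  exact MeasurableSet.iInter fun j => (measurableSet_singleton 0).compl.preimage
    (measurable_pi_apply j)

theorem cKappa_nonneg (d : ℕ) (κ : Fin d → ℝ) : 0 ≤ cKappa d κ :=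
  inv_nonneg.2 (integral_nonneg fun _ => (exp_pos _).le)

theorem exists_ratBox (hκ : ∀ j, 0 < κ j) (x : Fin d → ℝ) {r : ℝ} (hr : 0 < r) :
    ∃ i, x ∈ ratBox d i ∧ foldBox x r ⊆ ratBox d i ∧
      muK d κ (ratBox d i) ≤
        ENNReal.ofReal (4 ^ d * ((∏ j, (4 * 4 ^ (2 * κ j))) * foldWeight κ x r)) := by
  obtain ⟨q, hq1, hq2⟩ := exists_rat_btwn (show 2 * r < 3 * r by linarith)
  choose c hc1 hc2 using fun j => exists_rat_btwn (show x j - r < x j by linarith)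
  have hq0 : (0 : ℝ) < q := by linarith
  have hcx : ∀ j, |(|x j| - |(c j : ℝ)|)| < r := fun j =>
    (abs_abs_sub_abs_le_abs_sub _ _).trans_lt
      (abs_lt.2 ⟨by linarith [hc2 j], by linarith [hc1 j]⟩)
  refine ⟨(c, ⟨q, by exact_mod_cast hq0⟩), ?_, ?_, ?_⟩
  · exact mem_foldBox.2 fun j => (hcx j).trans (by linarith)
  · intro y hy
    refine mem_foldBox.2 fun j => ?_
    have h1 := abs_lt.1 (mem_foldBox.1 hy j)
    have h2 := abs_lt.1 (hcx j)
    change |(|y j| - |(c j : ℝ)|)| < (q : ℝ)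
    rw [abs_lt]
    constructor <;> linarith [h1.1, h1.2, h2.1, h2.2]
  · refine (muK_foldBox_le hκ _ hq0).trans (ENNReal.ofReal_le_ofReal ?_)
    refine mul_le_mul_of_nonneg_left ?_ (by positivity)
    rw [foldWeight, foldWeight, ← Finset.prod_mul_distrib]
    refine Finset.prod_le_prod (fun j _ => by positivity) fun j _ => ?_
    have h2 := abs_lt.1 (hcx j)
    calc (q : ℝ) * (|(c j : ℝ)| + q) ^ (2 * κ j) ≤ 4 * r * (4 * (|x j| + r)) ^ (2 * κ j) := by
          refine mul_le_mul (by linarith) (rpow_le_rpow (by positivity) ?_ (by linarith [hκ j]))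
            (by positivity) (by positivity)
          linarith [h2.1, abs_nonneg (x j)]
      _ = _ := by rw [Real.mul_rpow (by norm_num) (by positivity)]; ring

theorem exists_ofReal_abs_integral_le (hκ : ∀ j, 0 < κ j) :
    ∃ C : ℝ, 0 < C ∧ ∀ (f : (Fin d → ℝ) → ℝ), ∀ x ∈ regSet d, ∀ r : ℝ, 0 < r →
      ENNReal.ofReal |∫ y in regSet d, f y * (upsilon d κ x (-y) (eBall d r)).toReal ∂(muK d κ)| ≤
        ENNReal.ofReal (C * ∏ j, (r / (|x j| + r)) ^ (2 * κ j)) *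
          ∫⁻ y in foldBox x r, ENNReal.ofReal |f y| ∂(muK d κ) := by
  obtain ⟨C, hC0, hC⟩ := exists_upsilon_eBall_le hκ
  refine ⟨C, hC0, fun f x hx r hr => ?_⟩
  have hbox : MeasurableSet (foldBox x r) := MeasurableSet.univ_pi fun j => measurableSet_fold _ _
  rw [← Real.norm_eq_abs, ofReal_norm]
  refine (enorm_integral_le_lintegral_enorm _).trans ?_
  rw [← lintegral_const_mul' _ _ ENNReal.ofReal_ne_top, ← lintegral_indicator hbox]
  refine (setLIntegral_mono' (measurableSet_regSet d) fun y hy => ?_).trans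
    (setLIntegral_le_lintegral _ _)
  by_cases hyx : y ∈ foldBox x r
  · rw [indicator_of_mem hyx, enorm_mul, mul_comm, ← ofReal_norm (f y), Real.norm_eq_abs,
      ← ofReal_norm, Real.norm_of_nonneg ENNReal.toReal_nonneg]
    exact mul_le_mul' (ENNReal.ofReal_toReal_le.trans (hC x hx y hy r hr)) le_rfl
  · rw [upsilon_eBall_eq_zero hr hyx]
    simp

theorem exists_Mdunkl_le (hκ : ∀ j, 0 < κ j) :
    ∃ C : ℝ≥0, ∀ (f : (Fin d → ℝ) → ℝ) (x : Fin d → ℝ),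
      Mdunkl d κ f x ≤ C * maxOp (ratBox d) (muK d κ) (fun y => ENNReal.ofReal |f y|) x := by
  obtain ⟨A, hA0, hA⟩ := exists_ofReal_abs_integral_le hκ
  obtain ⟨c, hc0, hc⟩ := exists_le_muK_eBall hκ
  set E : ℝ := ∏ j, (4 * 4 ^ (2 * κ j)) with hE
  have hE0 : 0 < E := Finset.prod_pos fun j _ => by positivity
  have hK := cKappa_nonneg d κ
  refine ⟨(cKappa d κ * A * 4 ^ d * E / c).toNNReal, fun f x => ?_⟩
  unfold Mdunkl
  split_ifs with hx
  swap
  · exact zero_le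
  refine iSup₂_le fun r hr => ?_
  obtain ⟨i, hxi, hsub, hi⟩ := exists_ratBox hκ x hr
  set V := (muK d κ (eBall d r)).toReal with hV
  set P : ℝ := ∏ j, (r / (|x j| + r)) ^ (2 * κ j) with hP
  have hP0 : 0 ≤ P := Finset.prod_nonneg fun j _ => by positivity
  have hW0 := foldWeight_pos κ x hr
  have hR0 : 0 < ∏ j, (r * r ^ (2 * κ j)) := Finset.prod_pos fun j _ => by positivity
  have hPW : P * foldWeight κ x r = ∏ j, (r * r ^ (2 * κ j)) := by
    rw [hP, foldWeight, ← Finset.prod_mul_distrib]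
    refine Finset.prod_congr rfl fun j _ => ?_
    have h : 0 < |x j| + r := by positivity
    have := (rpow_pos_of_pos h (2 * κ j)).ne'
    rw [Real.div_rpow hr.le h.le]
    field_simp
  have hcV := hc r hr
  have hV0 : 0 < V := (mul_pos hc0 hR0).trans_le hcV
  have hbound : ∫⁻ y in foldBox x r, ENNReal.ofReal |f y| ∂(muK d κ) ≤
      muK d κ (ratBox d i) * maxOp (ratBox d) (muK d κ) (fun y => ENNReal.ofReal |f y|) x := by
    have hq : (0 : ℝ) < (i.2 : ℚ) := by exact_mod_cast i.2.2
    refine (lintegral_mono_set hsub).trans ?_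
    exact (ENNReal.inv_mul_le_iff (muK_foldBox_ne_zero hκ _ hq) (muK_foldBox_ne_top hκ _ hq)).1
      (le_maxOp hxi)
  rw [ENNReal.ofReal_mul (by positivity)]
  calc _ ≤ ENNReal.ofReal (cKappa d κ / V) * (ENNReal.ofReal (A * P) *
        (ENNReal.ofReal (4 ^ d * (E * foldWeight κ x r)) *
          maxOp (ratBox d) (muK d κ) (fun y => ENNReal.ofReal |f y|) x)) :=
        mul_le_mul' le_rfl ((hA f x hx r hr).trans
          (mul_le_mul' le_rfl (hbound.trans (mul_le_mul' hi le_rfl))))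
    _ = ENNReal.ofReal (cKappa d κ / V * (A * P * (4 ^ d * (E * foldWeight κ x r)))) *
          maxOp (ratBox d) (muK d κ) (fun y => ENNReal.ofReal |f y|) x := by
        rw [ENNReal.ofReal_mul (p := cKappa d κ / V) (by positivity),
          ENNReal.ofReal_mul (p := A * P) (by positivity)]
        ring
    _ ≤ _ := by
        refine mul_le_mul' (ENNReal.ofReal_le_ofReal ?_) le_rfl
        rw [show cKappa d κ / V * (A * P * (4 ^ d * (E * foldWeight κ x r))) =
          cKappa d κ * A * 4 ^ d * E * ((P * foldWeight κ x r) / V) by ring, hPW,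
          div_eq_mul_inv _ c]
        refine mul_le_mul_of_nonneg_left ?_ (by positivity)
        rw [div_le_iff₀ hV0, ← div_eq_inv_mul, le_div_iff₀ hc0]
        linarith

end PointwiseBound

/-- Fefferman–Stein inequalities for the `ℤ_2^d` Dunkl maximal operator: strong type. -/
theorem fefferman_stein_dunkl_strong
    (d : ℕ) (hd : 1 ≤ d) (κ : Fin d → ℝ) (hκ : ∀ j, 0 < κ j)
    (r p : ℝ) (hr : 1 < r) (hp : 1 < p) :
    ∃ C : ℝ, 0 < C ∧ ∀ f : ℕ → (Fin d → ℝ) → ℝ, (∀ n, Measurable (f n)) →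
      (∫⁻ x, ((∑' n, ENNReal.ofReal (|f n x|) ^ r) ^ (1/r)) ^ p ∂(muK d κ)) ^ (1/p) < ∞ →
      (∫⁻ x, ((∑' n, Mdunkl d κ (f n) x ^ r) ^ (1/r)) ^ p ∂(muK d κ)) ^ (1/p) ≤
        ENNReal.ofReal C *
          (∫⁻ x, ((∑' n, ENNReal.ofReal (|f n x|) ^ r) ^ (1/r)) ^ p ∂(muK d κ)) ^ (1/p) := by
  have hr0 : 0 < r := by linarith
  have hp0 : 0 < p := by linarith
  have hpr0 : 0 < p / r := by positivity
  obtain ⟨A, hA⟩ := exists_Mdunkl_le hκ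
  obtain ⟨K, hK⟩ := vector_valued_maxOp_ratBox hκ hr hp
  refine ⟨(A * K ^ (1 / p) : ℝ≥0) + 1, by positivity, fun f hf hfin => ?_⟩
  simp only [← ENNReal.rpow_mul, one_div_mul_eq_div] at hfin ⊢
  set J := ∫⁻ x, (∑' n, ENNReal.ofReal |f n x| ^ r) ^ (p / r) ∂(muK d κ) with hJ
  have hJtop : J ≠ ∞ := fun h => by
    rw [h, ENNReal.top_rpow_of_pos (by positivity)] at hfin
    exact lt_irrefl _ hfin
  have hpt : ∀ x, (∑' n, Mdunkl d κ (f n) x ^ r) ^ (p / r) ≤ (A : ℝ≥0∞) ^ p *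
      (∑' n, maxOp (ratBox d) (muK d κ) (fun y => ENNReal.ofReal |f n y|) x ^ r) ^ (p / r) := by
    intro x
    calc (∑' n, Mdunkl d κ (f n) x ^ r) ^ (p / r)
        ≤ (∑' n, (A : ℝ≥0∞) ^ r *
            maxOp (ratBox d) (muK d κ) (fun y => ENNReal.ofReal |f n y|) x ^ r) ^ (p / r) := by
          refine ENNReal.rpow_le_rpow (ENNReal.tsum_le_tsum fun n => ?_) hpr0.le
          rw [← ENNReal.mul_rpow_of_nonneg _ _ hr0.le]
          exact ENNReal.rpow_le_rpow (hA _ _) hr0.le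
      _ = _ := by
          rw [ENNReal.tsum_mul_left, ENNReal.mul_rpow_of_nonneg _ _ hpr0.le, ← ENNReal.rpow_mul,
            mul_div_cancel₀ _ hr0.ne']
  calc (∫⁻ x, (∑' n, Mdunkl d κ (f n) x ^ r) ^ (p / r) ∂(muK d κ)) ^ (1 / p)
      ≤ ((A : ℝ≥0∞) ^ p * (K * J)) ^ (1 / p) := by
        refine ENNReal.rpow_le_rpow ((lintegral_mono hpt).trans ?_) (by positivity)
        rw [lintegral_const_mul' _ _ (ENNReal.rpow_ne_top_of_nonneg hp0.le ENNReal.coe_ne_top)]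
        exact mul_le_mul' le_rfl (hK _ (fun n => (hf n).abs.ennreal_ofReal) hJtop)
    _ = ((A * K ^ (1 / p) : ℝ≥0) : ℝ≥0∞) * J ^ (1 / p) := by
        rw [ENNReal.mul_rpow_of_nonneg _ _ (by positivity),
          ENNReal.mul_rpow_of_nonneg _ _ (by positivity), ← ENNReal.rpow_mul,
          mul_one_div_cancel hp0.ne', ENNReal.rpow_one, ENNReal.coe_mul,
          ENNReal.coe_rpow_of_nonneg _ (by positivity), mul_assoc]
    _ ≤ _ := by
        refine mul_le_mul' ?_ le_rfl
        rw [← ENNReal.ofReal_coe_nnreal]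
        exact ENNReal.ofReal_le_ofReal (by linarith)
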